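/- Let F ⊆ (ω)^ω be a game filter, s, t ∈ (ℕ) and X ∈ F with s ⪯ t and t ⪯ X. Suppose D ⊆ (ω)^{0*}_s is 0-dense in (X)^{0*}_s, and the set K := {u ∈ (ℕ) : t ⪯ u and (u)^0_s ∩ D ≠ ∅} is dense in (t,Z) for some Z ∈ (t,X) ∩ F. Then there is t̄ ∈ (ℕ) with t ⪯ t̄, |t̄| = |t| + 1 and t̄* ⊑ Z such that (t̄)^0_s ⊆ D. -/

import Mathlib

namespace DualRamsey

/-- A partition: a set of pairwise disjoint nonempty blocks (subsets of ℕ). -/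
def IsPartition (P : Set (Set ℕ)) : Prop :=
  (∀ b ∈ P, b.Nonempty) ∧ ∀ b ∈ P, ∀ c ∈ P, b ≠ c → Disjoint b c

/-- The domain of a partition: the union of its blocks. -/
def pdom (P : Set (Set ℕ)) : Set ℕ := ⋃₀ P

/-- Membership in (ω)^ω : an infinite partition of ℕ. -/
def InfPart (X : Set (Set ℕ)) : Prop :=
  IsPartition X ∧ pdom X = Set.univ ∧ X.Infinite

/-- Membership in (ℕ) : a partition whose domain is {0, …, n−1} for some n. -/
def FinPart (s : Set (Set ℕ)) : Prop :=
  IsPartition s ∧ ∃ n : ℕ, pdom s = Set.Iio n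

/-- `Coarser P Q` means P ⊑ Q : P is coarser than Q, i.e. every block p of P satisfies
that p ∩ dom(Q) is a union of sets of the form q ∩ dom(P) with q a block of Q. -/
def Coarser (P Q : Set (Set ℕ)) : Prop :=
  ∀ p ∈ P, ∃ S ⊆ Q, p ∩ pdom Q = ⋃ q ∈ S, q ∩ pdom P

/-- `Segment s X` means s ⪯ X : for every block p of s there is a block q of X
with p = q ∩ dom(s). -/
def Segment (s X : Set (Set ℕ)) : Prop :=
  ∀ p ∈ s, ∃ q ∈ X, p = q ∩ pdom s

/-- For s ∈ (ℕ) with dom(s) = {0,…,n−1}, this is the number n. -/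
noncomputable def finBound (s : Set (Set ℕ)) : ℕ := sInf {n | pdom s = Set.Iio n}

/-- s* := s ∪ {{n}} where dom(s) = {0,…,n−1}. -/
noncomputable def sStar (s : Set (Set ℕ)) : Set (Set ℕ) := insert {finBound s} s

/-- The dual Ellentuck neighbourhood (s,X) := {Y ∈ (ω)^ω : s ⪯ Y and Y ⊑ X}. -/
def EllNbhd (s X : Set (Set ℕ)) : Set (Set (Set ℕ)) :=
  {Y | InfPart Y ∧ Segment s Y ∧ Coarser Y X}

/-- (s,X)^n := {u ∈ (ℕ) : |u| = n, s ⪯ u, u* ⊑ X}. -/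
def nseg (s X : Set (Set ℕ)) (n : ℕ) : Set (Set (Set ℕ)) :=
  {u | FinPart u ∧ u.ncard = n ∧ Segment s u ∧ Coarser (sStar u) X}

/-- (s,ω)^n := {u ∈ (ℕ) : |u| = n, s ⪯ u} (ω viewed as the partition into singletons). -/
def nsegOmega (s : Set (Set ℕ)) (n : ℕ) : Set (Set (Set ℕ)) :=
  {u | FinPart u ∧ u.ncard = n ∧ Segment s u}

/-- a and b lie in a common block of P. -/
def sameBlock (P : Set (Set ℕ)) (a b : ℕ) : Prop := ∃ p ∈ P, a ∈ p ∧ b ∈ p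

/-- P ⊓ Q : the finest partition coarser than both P and Q, with
dom(P ⊓ Q) = dom(P) ∪ dom(Q); its blocks are the classes of the equivalence
relation generated by "lying in a common block of P or of Q". -/
def pmeet (P Q : Set (Set ℕ)) : Set (Set ℕ) :=
  {b | ∃ a ∈ pdom P ∪ pdom Q,
    b = {c | Relation.EqvGen (fun u v => sameBlock P u v ∨ sameBlock Q u v) a c}}

/-- P ⊑* Q : P is almost coarser than Q, i.e. there is a partition R with finite
domain such that R ⊓ P ⊑ Q. -/
def AlmostCoarser (P Q : Set (Set ℕ)) : Prop :=
  ∃ R, IsPartition R ∧ (pdom R).Finite ∧ Coarser (pmeet R P) Q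

/-- A filter on (ω)^ω. -/
structure IsPFilter (F : Set (Set (Set ℕ))) : Prop where
  mem_infPart : ∀ X ∈ F, InfPart X
  empty_not_mem : ∅ ∉ F
  upward : ∀ X ∈ F, ∀ Y, InfPart Y → Coarser X Y → Y ∈ F
  meet_infPart : ∀ X ∈ F, ∀ Y ∈ F, InfPart (pmeet X Y)
  meet_mem : ∀ X ∈ F, ∀ Y ∈ F, pmeet X Y ∈ F

/-- An ultrafilter on (ω)^ω : a filter not properly contained in any other filter. -/
def IsPUltrafilter (F : Set (Set (Set ℕ))) : Prop :=
  IsPFilter F ∧ ∀ G, IsPFilter G → F ⊆ G → F = G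

/-- The segment colouring property. -/
def HasSCP (F : Set (Set (Set ℕ))) : Prop :=
  ∀ s, FinPart s → ∀ X ∈ F, Coarser s X → ∀ k r : ℕ, 1 ≤ s.ncard + k → 1 ≤ r →
    ∀ π : Set (Set ℕ) → ℕ, (∀ u ∈ nseg s X (s.ncard + k), π u < r) →
      ∃ Y ∈ EllNbhd s X, Y ∈ F ∧
        ∀ u ∈ nseg s Y (s.ncard + k), ∀ v ∈ nseg s Y (s.ncard + k), π u = π v

/-- `IsLCondWith E p s Xw` : p is an L*_E-condition with stem s and witness family Xw. -/
def IsLCondWith (E : Set (Set (Set ℕ))) (p : Set (Set (Set ℕ))) (s : Set (Set ℕ))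
    (Xw : Set (Set ℕ) → Set (Set ℕ)) : Prop :=
  (∀ t ∈ p, FinPart t) ∧
  s ∈ p ∧ (∀ t ∈ p, Segment s t) ∧
  (∀ t ∈ p, Xw t ∈ E) ∧
  (∀ t ∈ p, Coarser (sStar t) (Xw t)) ∧
  (∀ t ∈ p, {u | u ∈ p ∧ Segment t u ∧ u.ncard = t.ncard + 1}
      = nseg (sStar t) (Xw t) (t.ncard + 1)) ∧
  (∀ t ∈ p, ∀ u ∈ p, Segment t u → EllNbhd u (Xw u) ⊆ EllNbhd t (Xw t)) ∧
  (∀ t ∈ p, ∀ u ∈ p, pdom t = pdom u → Coarser t u → Xw t = Xw u)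

/-- X is a branch of the condition p with stem s. -/
def IsBranch (p : Set (Set (Set ℕ))) (s : Set (Set ℕ)) (X : Set (Set ℕ)) : Prop :=
  ∀ t, FinPart t → Segment s t → Coarser (sStar t) X → t ∈ p

/-- F is diagonalizable: every L*_F-condition has a branch in F. -/
def Diagonalizable (F : Set (Set (Set ℕ))) : Prop :=
  ∀ p s Xw, IsLCondWith F p s Xw → ∃ X ∈ F, IsBranch p s X

/-- A Ramsey* ultrafilter: a diagonalizable scp-filter. -/
def RamseyStar (F : Set (Set (Set ℕ))) : Prop :=
  IsPFilter F ∧ HasSCP F ∧ Diagonalizable F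

/-- O is F-open: a union of nonempty dual Ellentuck neighbourhoods (s,X) with X ∈ F. -/
def FOpen (F O : Set (Set (Set ℕ))) : Prop :=
  ∃ I : Set ((Set (Set ℕ)) × (Set (Set ℕ))),
    (∀ q ∈ I, FinPart q.1 ∧ q.2 ∈ F ∧ (EllNbhd q.1 q.2).Nonempty) ∧
    O = ⋃ q ∈ I, EllNbhd q.1 q.2

/-- (s,X) is good with respect to the F-open set O. -/
def FGood (F O : Set (Set (Set ℕ))) (s X : Set (Set ℕ)) : Prop :=
  ∃ Y ∈ EllNbhd s X, Y ∈ F ∧ EllNbhd s Y ⊆ O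

/-- (s,X) is ugly with respect to O: (t*,X) is bad for every t ∈ (ℕ) with
s ⪯ t*, t* ⊑ X and |t| = |s|. -/
def FUgly (F O : Set (Set (Set ℕ))) (s X : Set (Set ℕ)) : Prop :=
  ∀ t, FinPart t → Segment s (sStar t) → Coarser (sStar t) X → t.ncard = s.ncard →
    ¬ FGood F O (sStar t) X

/-- p is uniform with uniformity witness X (X = cu(p)). -/
def UniformWith (F : Set (Set (Set ℕ))) (p : Set (Set (Set ℕ)))
    (Xw : Set (Set ℕ) → Set (Set ℕ)) (X : Set (Set ℕ)) : Prop :=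
  X ∈ F ∧ ∀ t ∈ p, EllNbhd t X = EllNbhd t (Xw t)

/-- (X) := {Y ∈ (ω)^ω : Y ⊑ X}. -/
def coarsenings (X : Set (Set ℕ)) : Set (Set (Set ℕ)) :=
  {Y | InfPart Y ∧ Coarser Y X}

/-- A ⊆ (ω)^ω has the dual Ramsey property. -/
def IsDualRamsey (A : Set (Set (Set ℕ))) : Prop :=
  ∃ X, InfPart X ∧ (coarsenings X ⊆ A ∨ coarsenings X ∩ A = ∅)

/-- A ⊆ (ω)^ω is completely dual Ramsey. -/
def CompletelyDualRamsey (A : Set (Set (Set ℕ))) : Prop :=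
  ∀ s X, FinPart s → InfPart X → (EllNbhd s X).Nonempty →
    ∃ Y ∈ EllNbhd s X, (EllNbhd s Y ⊆ A ∨ EllNbhd s Y ∩ A = ∅)

/- ### Coding between reals and partitions -/

/-- The hypotheses on the fixed pairing function ♭ : it is (induced by) a bijection
between two-element subsets of ℕ and ℕ. -/
def FlatBijection (flat : ℕ → ℕ → ℕ) : Prop :=
  (∀ m n, flat m n = flat n m) ∧
  (∀ a b c d, a ≠ b → c ≠ d → flat a b = flat c d → ({a, b} : Set ℕ) = {c, d}) ∧
  (∀ k, ∃ a b, a ≠ b ∧ flat a b = k)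

/-- trans(x): the codes ♭({a,b}) of pairs {a,b} connected by a finite chain through x. -/
def ptrans (flat : ℕ → ℕ → ℕ) (x : Set ℕ) : Set ℕ :=
  {k | ∃ m : ℕ, ∃ f : ℕ → ℕ, 1 ≤ m ∧ f 0 ≠ f m ∧ k = flat (f 0) (f m) ∧
    ∀ i < m, flat (f i) (f (i + 1)) ∈ x}

/-- The equivalence relation n ∼ m iff n = m or ♭({n,m}) ∈ trans(x). -/
def cpRel (flat : ℕ → ℕ → ℕ) (x : Set ℕ) (n m : ℕ) : Prop :=
  n = m ∨ flat n m ∈ ptrans flat x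

/-- cp(x): the partition of ℕ whose blocks are the classes of cpRel. -/
def cp (flat : ℕ → ℕ → ℕ) (x : Set ℕ) : Set (Set ℕ) :=
  {b | ∃ n : ℕ, b = {m | cpRel flat x n m}}

/-- pc(X): the partition code of X. -/
def pcode (flat : ℕ → ℕ → ℕ) (X : Set (Set ℕ)) : Set ℕ :=
  {k | ∃ n m, n ≠ m ∧ sameBlock X n m ∧ k = flat n m}

/- ### The game G_F -/

/-- A move of player I: a pair ⟨t, Y⟩. -/
abbrev MoveI := (Set (Set ℕ)) × (Set (Set ℕ))

/-- The play (t, Y, X) follows the strategy σ of player I (σ reads off the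
previous moves of player II). -/
def Follows (σ : List (Set (Set ℕ)) → MoveI) (t Y X : ℕ → Set (Set ℕ)) : Prop :=
  ∀ n, σ (List.ofFn fun i : Fin n => X i) = (t n, Y n)

/-- Player I's n-th move in the play (t,Y,X) is legal. -/
def LegalI (F : Set (Set (Set ℕ))) (t Y X : ℕ → Set (Set ℕ)) (n : ℕ) : Prop :=
  FinPart (t n) ∧ Y n ∈ F ∧ (EllNbhd (sStar (t n)) (Y n)).Nonempty ∧
  ∀ m, n = m + 1 →
    Segment (sStar (t m)) (sStar (t n)) ∧ Coarser (sStar (t n)) (X m) ∧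
    (t n).ncard = (t m).ncard + 1

/-- Player II's n-th move in the play (t,Y,X) is legal. -/
def LegalII (F : Set (Set (Set ℕ))) (t Y X : ℕ → Set (Set ℕ)) (n : ℕ) : Prop :=
  X n ∈ F ∧ X n ∈ EllNbhd (sStar (t n)) (Y n)

/-- σ is a winning strategy for player I in G_F: against legal play of II it always
produces legal moves, and in every legal play following σ player I wins, i.e. any
Y ∈ (ω)^ω with t_n ⪯ Y for all n is not in F. -/
def WinningStratI (F : Set (Set (Set ℕ))) (σ : List (Set (Set ℕ)) → MoveI) : Prop :=
  ∀ t Y X, Follows σ t Y X →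
    (∀ n, (∀ m < n, LegalII F t Y X m) → LegalI F t Y X n) ∧
    ((∀ n, LegalII F t Y X n) →
      ∀ Z, InfPart Z → (∀ n, Segment (t n) Z) → Z ∉ F)

/-- A game filter: an ultrafilter such that player I has no winning strategy in G_F. -/
def GameFilter (F : Set (Set (Set ℕ))) : Prop :=
  IsPUltrafilter F ∧ ∀ σ, ¬ WinningStratI F σ

/- ### Density notions for the appendix -/

/-- (t)^0_s := {u ∈ (ℕ) : dom(u) = dom(t), s ⪯ u, u ⊑ t, |u| = |s|}. -/
def iseg0 (s t : Set (Set ℕ)) : Set (Set (Set ℕ)) :=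
  {u | FinPart u ∧ pdom u = pdom t ∧ Segment s u ∧ Coarser u t ∧ u.ncard = s.ncard}

/-- K ⊆ (ℕ) is dense in (t,X): for every Y ∈ (t,X) ∩ F there is u ∈ K with
t ⪯ u* and u* ⊑ Y. -/
def DenseIn (F : Set (Set (Set ℕ))) (K : Set (Set (Set ℕ))) (t X : Set (Set ℕ)) : Prop :=
  ∀ Y ∈ EllNbhd t X, Y ∈ F → ∃ u ∈ K, Segment t (sStar u) ∧ Coarser (sStar u) Y

/-- D is 0-dense in (X)^{0*}_s: for every Y ∈ (s,X) ∩ F there is u ∈ D with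
s ⪯ u* and u* ⊑ Y. -/
def ZeroDense (F : Set (Set (Set ℕ))) (D : Set (Set (Set ℕ))) (s X : Set (Set ℕ)) : Prop :=
  ∀ Y ∈ EllNbhd s X, Y ∈ F → ∃ u ∈ D, Segment s (sStar u) ∧ Coarser (sStar u) Y

/-- (t,X)^{k*}_s := {u ∈ (ℕ) : t ⪯ u*, u* ⊑ X, |u| = |s| + k}. -/
def tseg (s t X : Set (Set ℕ)) (k : ℕ) : Set (Set (Set ℕ)) :=
  {u | FinPart u ∧ Segment t (sStar u) ∧ Coarser (sStar u) X ∧ u.ncard = s.ncard + k}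

/-- E is k-dense in (t,X)^{k*}_s: for every Y ∈ (t,X) ∩ F, (t,Y)^{k*}_s ∩ E ≠ ∅. -/
def KDense (F : Set (Set (Set ℕ))) (E : Set (Set (Set ℕ))) (s t X : Set (Set ℕ))
    (k : ℕ) : Prop :=
  ∀ Y ∈ EllNbhd t X, Y ∈ F → (tseg s t Y k ∩ E).Nonempty

/-! ### Partitions of `ℕ` as setoids -/

/-- The least element of the class of `i`. -/
noncomputable def minRep (Y : Setoid ℕ) (i : ℕ) : ℕ := sInf {j | Y i j}

/-- `n` is the least element of its class. -/
def IsLeader (Y : Setoid ℕ) (n : ℕ) : Prop := ∀ i < n, ¬ Y i n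

/-- `Y` and `Z` have the same restriction to `{0, …, k - 1}`. -/
def Agree (k : ℕ) (Y Z : Setoid ℕ) : Prop := ∀ i < k, ∀ j < k, (Y i j ↔ Z i j)

/-- `n` is the first leader of `Y` that is at least `k`. -/
def IsNext (k : ℕ) (Y : Setoid ℕ) (n : ℕ) : Prop :=
  k ≤ n ∧ IsLeader Y n ∧ ∀ i < n, ∃ j < k, Y i j

theorem rel_minRep (Y : Setoid ℕ) (i : ℕ) : Y i (minRep Y i) :=
  Nat.sInf_mem (s := {j | Y i j}) ⟨i, Y.refl' i⟩

theorem minRep_le_of_rel {Y : Setoid ℕ} {i j : ℕ} (h : Y i j) : minRep Y i ≤ j :=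
  Nat.sInf_le h

theorem minRep_le (Y : Setoid ℕ) (i : ℕ) : minRep Y i ≤ i := minRep_le_of_rel (Y.refl' i)

theorem minRep_eq_iff {Y : Setoid ℕ} {i j : ℕ} : minRep Y i = minRep Y j ↔ Y i j := by
  constructor
  · intro h
    exact Y.trans' (rel_minRep Y i) (h ▸ Y.symm' (rel_minRep Y j))
  · intro h
    apply le_antisymm
    · exact minRep_le_of_rel (Y.trans' h (rel_minRep Y j))
    · exact minRep_le_of_rel (Y.trans' (Y.symm' h) (rel_minRep Y i))

theorem minRep_minRep (Y : Setoid ℕ) (i : ℕ) : minRep Y (minRep Y i) = minRep Y i :=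
  minRep_eq_iff.2 (Y.symm' (rel_minRep Y i))

theorem minRep_eq_of_isLeader {Y : Setoid ℕ} {n : ℕ} (h : IsLeader Y n) : minRep Y n = n := by
  by_contra hne
  exact h _ (lt_of_le_of_ne (minRep_le Y n) hne) (Y.symm' (rel_minRep Y n))

theorem isLeader_of_minRep_eq {Y : Setoid ℕ} {n : ℕ} (h : minRep Y n = n) : IsLeader Y n := by
  intro i hi hr
  have := minRep_le_of_rel (Y.symm' hr)
  omega

theorem isLeader_minRep (Y : Setoid ℕ) (i : ℕ) : IsLeader Y (minRep Y i) :=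
  isLeader_of_minRep_eq (minRep_minRep Y i)

theorem IsLeader.mono {Y Z : Setoid ℕ} {n : ℕ} (h : IsLeader Z n) (hYZ : Y ≤ Z) : IsLeader Y n :=
  fun i hi hr => h i hi (hYZ hr)

theorem minRep_anti {Y Z : Setoid ℕ} (h : Y ≤ Z) (i : ℕ) : minRep Z i ≤ minRep Y i :=
  minRep_le_of_rel (h (rel_minRep Y i))

theorem minRep_minRep_of_le {Y Z : Setoid ℕ} (h : Y ≤ Z) (i : ℕ) :
    minRep Z (minRep Y i) = minRep Z i :=
  minRep_eq_iff.2 (Z.symm' (h (rel_minRep Y i)))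

theorem Agree.refl (k : ℕ) (Y : Setoid ℕ) : Agree k Y Y := fun _ _ _ _ => Iff.rfl

theorem Agree.symm {k : ℕ} {Y Z : Setoid ℕ} (h : Agree k Y Z) : Agree k Z Y :=
  fun i hi j hj => (h i hi j hj).symm

theorem Agree.trans {k : ℕ} {Y Z W : Setoid ℕ} (h : Agree k Y Z) (h' : Agree k Z W) :
    Agree k Y W :=
  fun i hi j hj => (h i hi j hj).trans (h' i hi j hj)

theorem Agree.of_le {k m : ℕ} {Y Z : Setoid ℕ} (h : Agree m Y Z) (hk : k ≤ m) : Agree k Y Z :=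
  fun i hi j hj => h i (by omega) j (by omega)

theorem Agree.minRep_eq {k : ℕ} {Y Z : Setoid ℕ} (h : Agree k Y Z) {i : ℕ} (hi : i < k) :
    minRep Y i = minRep Z i := by
  apply le_antisymm
  · have := minRep_le Z i
    exact minRep_le_of_rel ((h i hi _ (by omega)).2 (rel_minRep Z i))
  · have := minRep_le Y i
    exact minRep_le_of_rel ((h i hi _ (by omega)).1 (rel_minRep Y i))

theorem Agree.isLeader {k : ℕ} {Y Z : Setoid ℕ} (h : Agree k Y Z) {i : ℕ} (hi : i < k)
    (hl : IsLeader Y i) : IsLeader Z i :=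
  isLeader_of_minRep_eq (by rw [← h.minRep_eq hi, minRep_eq_of_isLeader hl])

theorem IsNext.minRep_lt {k n : ℕ} {Y : Setoid ℕ} (h : IsNext k Y n) {i : ℕ} (hi : i < n) :
    minRep Y i < k := by
  obtain ⟨j, hj, hr⟩ := h.2.2 i hi
  exact lt_of_le_of_lt (minRep_le_of_rel hr) hj

/-- If `Y` and `Z` agree up to `k` and every number below `n` is represented below `k` by the
same number in both, they agree up to `n`. -/
theorem Agree.of_reps {k n : ℕ} {Y Z : Setoid ℕ} (h : Agree k Y Z)
    (hr : ∀ i < n, ∃ j < k, Y i j ∧ Z i j) : Agree n Y Z := by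
  intro i hi j hj
  obtain ⟨a, ha, hYa, hZa⟩ := hr i hi
  obtain ⟨b, hb, hYb, hZb⟩ := hr j hj
  constructor
  · intro hij
    exact Z.trans' hZa (Z.trans' ((h a ha b hb).1
      (Y.trans' (Y.symm' hYa) (Y.trans' hij hYb))) (Z.symm' hZb))
  · intro hij
    exact Y.trans' hYa (Y.trans' ((h a ha b hb).2
      (Z.trans' (Z.symm' hZa) (Z.trans' hij hZb))) (Y.symm' hYb))

theorem IsNext.agree {k n : ℕ} {Y Z : Setoid ℕ} (h : IsNext k Y n) (hYZ : Y ≤ Z)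
    (ha : Agree k Y Z) : Agree n Y Z :=
  ha.of_reps fun i hi => by
    obtain ⟨j, hj, hr⟩ := h.2.2 i hi
    exact ⟨j, hj, hr, hYZ hr⟩

/-- Merge the classes of `Y` that meet `{0, …, K - 1}` according to the relation `T` between
their least elements, and keep the other classes. -/
def mergeBelow (K : ℕ) (T Y : Setoid ℕ) : Setoid ℕ where
  r i j := (minRep Y i < K ∧ minRep Y j < K ∧ T (minRep Y i) (minRep Y j)) ∨
    (K ≤ minRep Y i ∧ minRep Y i = minRep Y j)
  iseqv :=
    { refl := fun i => by
        rcases lt_or_ge (minRep Y i) K with h | h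
        · exact Or.inl ⟨h, h, T.refl' _⟩
        · exact Or.inr ⟨h, rfl⟩
      symm := by
        rintro i j (⟨h1, h2, h3⟩ | ⟨h1, h2⟩)
        · exact Or.inl ⟨h2, h1, T.symm' h3⟩
        · exact Or.inr ⟨h2 ▸ h1, h2.symm⟩
      trans := by
        rintro i j l (⟨h1, h2, h3⟩ | ⟨h1, h2⟩) (⟨h4, h5, h6⟩ | ⟨h4, h5⟩)
        · exact Or.inl ⟨h1, h5, T.trans' h3 h6⟩
        · omega
        · omega
        · exact Or.inr ⟨h1, h2.trans h5⟩ }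

theorem mergeBelow_apply {K : ℕ} {T Y : Setoid ℕ} {i j : ℕ} : mergeBelow K T Y i j ↔
    (minRep Y i < K ∧ minRep Y j < K ∧ T (minRep Y i) (minRep Y j)) ∨
      (K ≤ minRep Y i ∧ minRep Y i = minRep Y j) := Iff.rfl

theorem le_mergeBelow (K : ℕ) (T Y : Setoid ℕ) : Y ≤ mergeBelow K T Y := by
  intro i j h
  have h' := minRep_eq_iff.2 h
  rw [mergeBelow_apply, ← h']
  rcases lt_or_ge (minRep Y i) K with hl | hl
  · exact Or.inl ⟨hl, hl, T.refl' _⟩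
  · exact Or.inr ⟨hl, rfl⟩

theorem mergeBelow_le_top (K : ℕ) (T Y : Setoid ℕ) : mergeBelow K T Y ≤ mergeBelow K ⊤ Y := by
  rintro i j (⟨h1, h2, _⟩ | h)
  · exact Or.inl ⟨h1, h2, trivial⟩
  · exact Or.inr h

theorem IsLeader.mergeBelow {K n : ℕ} {Y : Setoid ℕ} (h : IsLeader Y n) (hK : K ≤ n)
    (T : Setoid ℕ) : IsLeader (mergeBelow K T Y) n := by
  have hn := minRep_eq_of_isLeader h
  rintro i hi (⟨_, h2, _⟩ | ⟨_, h2⟩)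
  · omega
  · have := minRep_le Y i
    omega

theorem mergeBelow_apply_of_lt {K : ℕ} {T Y : Setoid ℕ} {i j : ℕ} (hi : i < K) (hj : j < K) :
    mergeBelow K T Y i j ↔ T (minRep Y i) (minRep Y j) := by
  have h1 := minRep_le Y i
  have h2 := minRep_le Y j
  rw [mergeBelow_apply]
  constructor
  · rintro (⟨_, _, h⟩ | ⟨h, _⟩)
    · exact h
    · omega
  · intro h
    exact Or.inl ⟨by omega, by omega, h⟩

theorem mergeBelow_mono {K : ℕ} {Y Z : Setoid ℕ} (T : Setoid ℕ) (h : Y ≤ Z) (ha : Agree K Y Z) :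
    mergeBelow K T Y ≤ mergeBelow K T Z := by
  have key : ∀ i, minRep Y i < K → minRep Z i = minRep Y i := by
    intro i hi
    rw [← minRep_minRep_of_le h, ← ha.minRep_eq hi, minRep_minRep]
  rintro i j (⟨h1, h2, h3⟩ | ⟨h1, h2⟩)
  · rw [mergeBelow_apply, key i h1, key j h2]
    exact Or.inl ⟨h1, h2, h3⟩
  · exact le_mergeBelow K T Z (h (minRep_eq_iff.1 h2))

theorem Agree.mergeBelow {K n : ℕ} {Y Z : Setoid ℕ} (T : Setoid ℕ) (ha : Agree n Y Z) :
    Agree n (mergeBelow K T Y) (mergeBelow K T Z) := by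
  intro i hi j hj
  rw [mergeBelow_apply, mergeBelow_apply, ha.minRep_eq hi, ha.minRep_eq hj]

/-- Split the classes of `Z ≥ Y` that meet `{0, …, K - 1}` so that the result restricts to the
same partition of `{0, …, K - 1}` as `Y`. -/
noncomputable def splitBelow (K : ℕ) (Y Z : Setoid ℕ) : Setoid ℕ :=
  Setoid.ker fun i => if minRep Y i < K then minRep Y i else minRep Z i

theorem splitBelow_apply {K : ℕ} {Y Z : Setoid ℕ} {i j : ℕ} : splitBelow K Y Z i j ↔
    (if minRep Y i < K then minRep Y i else minRep Z i) =
      if minRep Y j < K then minRep Y j else minRep Z j := Iff.rfl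

theorem le_splitBelow {K : ℕ} {Y Z : Setoid ℕ} (h : Y ≤ Z) : Y ≤ splitBelow K Y Z := by
  intro i j hij
  rw [splitBelow_apply, minRep_eq_iff.2 hij, minRep_eq_iff.2 (h hij)]

theorem splitBelow_le {K : ℕ} {Y Z : Setoid ℕ} (h : Y ≤ Z) : splitBelow K Y Z ≤ Z := by
  intro i j hij
  rw [splitBelow_apply] at hij
  have key : ∀ i, minRep Z (if minRep Y i < K then minRep Y i else minRep Z i) = minRep Z i := by
    intro i
    split_ifs
    · exact minRep_minRep_of_le h i
    · exact minRep_minRep Z i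
  rw [← minRep_eq_iff, ← key i, ← key j, hij]

theorem agree_splitBelow (K : ℕ) (Y Z : Setoid ℕ) : Agree K Y (splitBelow K Y Z) := by
  intro i hi j hj
  have h1 := minRep_le Y i
  have h2 := minRep_le Y j
  rw [splitBelow_apply, if_pos (by omega), if_pos (by omega), minRep_eq_iff]

theorem exists_splitBelow_rel {K : ℕ} {Y Z : Setoid ℕ} (h : Y ≤ Z) {i : ℕ} (hi : minRep Z i < K) :
    ∃ j < K, splitBelow K Y Z i j := by
  by_cases hY : minRep Y i < K
  · exact ⟨_, hY, le_splitBelow h (rel_minRep Y i)⟩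
  · refine ⟨_, hi, ?_⟩
    have : minRep Y (minRep Z i) = minRep Z i :=
      minRep_eq_of_isLeader ((isLeader_minRep Z i).mono h)
    rw [splitBelow_apply, if_neg hY, this, if_pos hi]

theorem le_mergeBelow_splitBelow {K : ℕ} {T Y Z : Setoid ℕ} (h : Y ≤ Z)
    (hT : ∀ i < K, ∀ j < K, Z i j → T (minRep Y i) (minRep Y j)) :
    Z ≤ mergeBelow K T (splitBelow K Y Z) := by
  intro i j hij
  have hm := minRep_eq_iff.2 hij
  set S := splitBelow K Y Z with hS
  by_cases hi : minRep Z i < K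
  · obtain ⟨a, ha, hSa⟩ := exists_splitBelow_rel h hi
    obtain ⟨b, hb, hSb⟩ := exists_splitBelow_rel h (hm ▸ hi)
    have hZ : Z a b := Z.trans' (Z.symm' (splitBelow_le h hSa))
      (Z.trans' hij (splitBelow_le h hSb))
    have hab : mergeBelow K T S a b := by
      rw [mergeBelow_apply_of_lt ha hb, ← (agree_splitBelow K Y Z).minRep_eq ha,
        ← (agree_splitBelow K Y Z).minRep_eq hb]
      exact hT a ha b hb hZ
    have := le_mergeBelow K T S
    exact Setoid.trans' _ (this hSa) (Setoid.trans' _ hab (Setoid.symm' _ (this hSb)))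
  · apply le_mergeBelow K T S
    have h1 := minRep_anti h i
    have h2 := minRep_anti h j
    rw [hS, splitBelow_apply, if_neg (by omega), if_neg (by omega), hm]

/-! ### Families of setoids with the game property -/

/-- `Y` belongs to `A`, is coarser than `X`, and agrees with `X` up to `k`. -/
def Ext (A : Set (Setoid ℕ)) (k : ℕ) (X Y : Setoid ℕ) : Prop := Y ∈ A ∧ X ≤ Y ∧ Agree k X Y

/-- The properties of a game filter, in terms of setoids, on which the combinatorics rests. -/
structure GameFam (A : Set (Setoid ℕ)) : Prop where
  exists_isLeader : ∀ Y ∈ A, ∀ k, ∃ n ≥ k, IsLeader Y n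
  mem_of_le : ∀ Y ∈ A, ∀ Z, Z ≤ Y → Z ∈ A
  mergeBelow_top_mem : ∀ Y ∈ A, ∀ K, mergeBelow K ⊤ Y ∈ A
  game : ∀ (good : ℕ → Setoid ℕ → Prop) (k : ℕ) (X : Setoid ℕ), X ∈ A → good k X →
    (∀ k' X', good k' X' → ∀ X'', Ext A k' X' X'' →
      ∃ Y n, Ext A k' X'' Y ∧ IsNext k' Y n ∧ good (n + 1) Y) →
    ∃ Y, Ext A k X Y ∧ ∀ n ≥ k, IsLeader Y n → ∃ Y', Ext A (n + 1) Y' Y ∧ good (n + 1) Y'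

/-- Below every extension of `X` there is a further extension whose first new leader `n`
satisfies `D n`. -/
def Dense (A : Set (Setoid ℕ)) (k : ℕ) (D : ℕ → Setoid ℕ → Prop) (X : Setoid ℕ) : Prop :=
  ∀ Y, Ext A k X Y → ∃ Y' n, Ext A k Y Y' ∧ IsNext k Y' n ∧ D n Y'

/-- For a leader `n` of `Y`, `D n Y` depends only on the restriction of `Y` to `n`. -/
def Inv (A : Set (Setoid ℕ)) (D : ℕ → Setoid ℕ → Prop) : Prop :=
  ∀ n, ∀ Y ∈ A, ∀ Z ∈ A, IsLeader Y n → IsLeader Z n → Agree n Y Z → D n Y → D n Z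

/-- Some extension of `Y` with first new leader `n` satisfies `D n`. -/
def SomeExt (A : Set (Setoid ℕ)) (k : ℕ) (D : ℕ → Setoid ℕ → Prop) (n : ℕ) (Y : Setoid ℕ) :
    Prop :=
  ∃ Z, Ext A k Y Z ∧ IsNext k Z n ∧ D n Z

/-- All extensions of `Y` with first new leader `n` satisfy `D n`. -/
def AllExt (A : Set (Setoid ℕ)) (k : ℕ) (D : ℕ → Setoid ℕ → Prop) (n : ℕ) (Y : Setoid ℕ) :
    Prop :=
  ∀ Z, Ext A k Y Z → IsNext k Z n → D n Z

section GameFam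

variable {A : Set (Setoid ℕ)} {D : ℕ → Setoid ℕ → Prop} {k k' n K : ℕ} {X Y Z W : Setoid ℕ}

theorem Ext.refl (k : ℕ) (h : X ∈ A) : Ext A k X X := ⟨h, le_rfl, Agree.refl k X⟩

theorem Ext.trans (h : Ext A k X Y) (h' : Ext A k Y Z) : Ext A k X Z :=
  ⟨h'.1, h.2.1.trans h'.2.1, h.2.2.trans h'.2.2⟩

theorem Ext.of_le (h : Ext A k' X Y) (hk : k ≤ k') : Ext A k X Y :=
  ⟨h.1, h.2.1, h.2.2.of_le hk⟩

theorem Dense.of_ext (h : Dense A k D X) (hX : Ext A k X Y) : Dense A k D Y :=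
  fun W hW => h W (hX.trans hW)

theorem AllExt.of_ext (h : AllExt A k D n X) (hX : Ext A k X Y) : AllExt A k D n Y :=
  fun W hW hn => h W (hX.trans hW) hn

theorem GameFam.mergeBelow_mem (hA : GameFam A) (T : Setoid ℕ) (K : ℕ) (hY : Y ∈ A) :
    mergeBelow K T Y ∈ A :=
  hA.mem_of_le _ (hA.mergeBelow_top_mem Y hY K) _ (mergeBelow_le_top K T Y)

theorem GameFam.splitBelow_ext (hA : GameFam A) (K : ℕ) (hYZ : Y ≤ Z) (hZ : Z ∈ A) :
    Ext A K Y (splitBelow K Y Z) :=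
  ⟨hA.mem_of_le _ hZ _ (splitBelow_le hYZ), le_splitBelow hYZ, agree_splitBelow K Y Z⟩

theorem GameFam.exists_isNext (hA : GameFam A) (hY : Y ∈ A) (k : ℕ) : ∃ n, IsNext k Y n := by
  classical
  have h := hA.exists_isLeader Y hY k
  refine ⟨Nat.find h, (Nat.find_spec h).1, (Nat.find_spec h).2, fun i hi => ?_⟩
  refine ⟨minRep Y i, ?_, rel_minRep Y i⟩
  by_contra hk
  exact Nat.find_min h (lt_of_le_of_lt (minRep_le Y i) hi) ⟨not_lt.1 hk, isLeader_minRep Y i⟩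

theorem IsNext.of_agree (h : IsNext k Y n) (ha : Agree n Y Z) (hZ : IsLeader Z n) :
    IsNext k Z n := by
  refine ⟨h.1, hZ, fun i hi => ?_⟩
  obtain ⟨j, hj, hr⟩ := h.2.2 i hi
  exact ⟨j, hj, (ha i hi j (hj.trans_le h.1)).1 hr⟩

theorem agree_mergeBelow_self (ha : Agree n Y W) (hWZ : W ≤ Z) : Agree n (mergeBelow n Z Y) Z := by
  intro i hi j hj
  rw [mergeBelow_apply_of_lt hi hj, ha.minRep_eq hi, ha.minRep_eq hj]
  have h1 := hWZ (rel_minRep W i)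
  have h2 := hWZ (rel_minRep W j)
  exact ⟨fun h => Z.trans' h1 (Z.trans' h (Z.symm' h2)),
    fun h => Z.trans' (Z.symm' h1) (Z.trans' h h2)⟩

theorem Inv.allExt (hA : GameFam A) (hD : Inv A D) (k : ℕ) : Inv A (AllExt A k D) := by
  intro n Y hY W hW hYn hWn ha h Z hZ hn
  have hag : Agree n (mergeBelow n Z Y) Z := agree_mergeBelow_self ha hZ.2.1
  have hmem : mergeBelow n Z Y ∈ A := hA.mergeBelow_mem Z n hY
  have hlead : IsLeader (mergeBelow n Z Y) n := hYn.mergeBelow le_rfl Z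
  refine hD n _ hmem Z hZ.1 hlead hn.2.1 hag (h _ ⟨hmem, le_mergeBelow n Z Y, ?_⟩
    (hn.of_agree hag.symm hlead))
  exact ((ha.of_le hn.1).trans hZ.2.2).trans (hag.symm.of_le hn.1)

theorem AllExt.of_allExt (hA : GameFam A) (hk : k ≤ k') (hn : k' ≤ n)
    (h : AllExt A k' (AllExt A k D) n Y) : AllExt A k D n Y := by
  intro Z hZ hnZ
  have hS := hA.splitBelow_ext k' hZ.2.1 hZ.1
  have hle := splitBelow_le (K := k') hZ.2.1
  refine h _ hS ⟨hn, hnZ.2.1.mono hle, fun i hi =>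
    exists_splitBelow_rel hZ.2.1 ((hnZ.minRep_lt hi).trans_le hk)⟩ Z
    ⟨hZ.1, hle, (hS.2.2.of_le hk).symm.trans hZ.2.2⟩ hnZ

theorem Inv.allExt_of_isNext (hD : Inv A D) (hY : Y ∈ A) (hn : IsNext k Y n) (h : D n Y) :
    AllExt A k D n Y :=
  fun Z hZ hnZ => hD n Y hY Z hZ.1 hn.2.1 hnZ.2.1 (hn.agree hZ.2.1 hZ.2.2) h

/-- Finitely many properties that are preserved under extensions and can be reached one at a
time can be reached simultaneously. -/
theorem exists_ext_forall {Φ : Type*} [Finite Φ] (P : Φ → Setoid ℕ → Prop)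
    (hP : ∀ φ Y Z, P φ Y → Ext A K Y Z → P φ Z) (hX : X ∈ A)
    (h : ∀ φ Y, Ext A K X Y → ∃ Z, Ext A K Y Z ∧ P φ Z) :
    ∃ Y, Ext A K X Y ∧ ∀ φ, P φ Y := by
  classical
  have := Fintype.ofFinite Φ
  suffices ∀ S : Finset Φ, ∃ Y, Ext A K X Y ∧ ∀ φ ∈ S, P φ Y by
    obtain ⟨Y, hY, hall⟩ := this Finset.univ
    exact ⟨Y, hY, fun φ => hall φ (Finset.mem_univ φ)⟩
  intro S
  induction S using Finset.induction_on with
  | empty => exact ⟨X, Ext.refl K hX, by simp⟩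
  | insert a S _ ih =>
    obtain ⟨Y, hY, hall⟩ := ih
    obtain ⟨Z, hZ, hPZ⟩ := h a Y hY
    refine ⟨Z, hY.trans hZ, fun φ hφ => ?_⟩
    rcases Finset.mem_insert.1 hφ with rfl | hφ
    · exact hPZ
    · exact hP φ Y Z (hall φ hφ) hZ

/-- A dense property is decided by some extension of `X` at some later stage. -/
theorem Dense.exists_someExt (hA : GameFam A) (hX : X ∈ A) (h : Dense A k D X) :
    ∃ k' X', k ≤ k' ∧ Ext A k X X' ∧
      ∀ Y n, Ext A k' X' Y → IsNext k' Y n → SomeExt A k D n Y := by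
  by_contra! hno
  obtain ⟨Y, hY, hlead⟩ := hA.game
    (fun k' X' => Ext A k X X' ∧ k ≤ k' ∧ (k' = k ∨ ¬ SomeExt A k D (k' - 1) X')) k X hX
    ⟨Ext.refl k hX, le_rfl, Or.inl rfl⟩ (by
      rintro k' X' ⟨hX', hk, -⟩ X'' hX''
      obtain ⟨Y, n, hY, hn, hs⟩ := hno k' X'' hk (hX'.trans (hX''.of_le hk))
      refine ⟨Y, n, hY, hn, hX'.trans ((hX''.trans hY).of_le hk), ?_, Or.inr hs⟩
      have := hn.1
      omega)
  obtain ⟨Y', n, hY', hn, hDn⟩ := h Y hY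
  obtain ⟨Z, hZ, -, -, hs⟩ := hlead n hn.1 (hn.2.1.mono hY'.2.1)
  have hkn := hn.1
  rcases hs with hs | hs
  · omega
  · exact hs ⟨Y', (hZ.of_le (by omega)).trans hY', hn, hDn⟩

theorem mergeBelow_comap_apply {ρ : ℕ → ℕ} (ha : Agree K X Y) {i j : ℕ} (hi : i < K) (hj : j < K) :
    mergeBelow K (X.comap ρ) Y i j ↔ X (ρ (minRep X i)) (ρ (minRep X j)) := by
  rw [mergeBelow_apply_of_lt hi hj, ← ha.minRep_eq hi, ← ha.minRep_eq hj]
  exact Iff.rfl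

theorem mergeBelow_comap_rel {ρ : ℕ → ℕ} (ha : Agree K X Y) {c : ℕ} (hc : c < K)
    (hX : IsLeader X c) (hρ : ρ c < K) (hfix : ρ (minRep X (ρ c)) = minRep X (ρ c)) :
    mergeBelow K (X.comap ρ) Y c (ρ c) := by
  rw [mergeBelow_comap_apply ha hc hρ, minRep_eq_of_isLeader hX, hfix]
  exact rel_minRep X _

theorem agree_mergeBelow_comap {ρ : ℕ → ℕ} (ha : Agree K X Y) (hk : k ≤ K)
    (hρ : ∀ c < k, ρ c = c) : Agree k X (mergeBelow K (X.comap ρ) Y) := by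
  intro i hi j hj
  have h1 := minRep_le X i
  have h2 := minRep_le X j
  rw [mergeBelow_comap_apply ha (by omega) (by omega), hρ _ (by omega), hρ _ (by omega),
    ← minRep_eq_iff (i := minRep X i), minRep_minRep, minRep_minRep, minRep_eq_iff]

theorem ext_mergeBelow_comap (hA : GameFam A) {ρ : ℕ → ℕ} (hY : Ext A K X Y) (hk : k ≤ K)
    (hρ : ∀ c < k, ρ c = c) : Ext A k X (mergeBelow K (X.comap ρ) Y) :=
  ⟨hA.mergeBelow_mem _ K hY.1, hY.2.1.trans (le_mergeBelow _ _ _),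
    agree_mergeBelow_comap hY.2.2 hk hρ⟩

/-- Send every number in `[k', ∞)` to a number below `k` via the word `a`. -/
def wordMap {ι : Type*} (k' : ℕ) (q : ℕ → ι) (a : ι → Fin k) (c : ℕ) : ℕ :=
  if c < k' then c else a (q c)

/-- Send every number in `[k, k')` to a number below `k` via `g`, and every number in `[k', ∞)`
to a number below `k` or to `x` via the variable word `h`. -/
def lineMap {ι : Type*} (k' : ℕ) (q : ℕ → ι) (x : ℕ) (g : Fin k' → Fin k)
    (h : ι → Option (Fin k)) (c : ℕ) : ℕ :=
  if c < k then c else if hc : c < k' then g ⟨c, hc⟩ else (h (q c)).elim x (fun b => (b : ℕ))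

section lineMap

variable {ι : Type*} {q : ℕ → ι} {x : ℕ} {g : Fin k' → Fin k} {h : ι → Option (Fin k)}

theorem lineMap_of_lt {c : ℕ} (hc : c < k) : lineMap k' q x g h c = c := if_pos hc

theorem lineMap_self (hkx : k ≤ x) (hx : k' ≤ x) (hq : h (q x) = none) :
    lineMap k' q x g h x = x := by
  rw [lineMap, if_neg (by omega), dif_neg (by omega), hq, Option.elim_none]

theorem lineMap_lt_or_eq (c : ℕ) :
    lineMap k' q x g h c < k ∨
      (lineMap k' q x g h c = x ∧ k' ≤ c ∧ h (q c) = none) := by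
  unfold lineMap
  split_ifs with h1 h2
  · exact Or.inl h1
  · exact Or.inl (g _).2
  · cases hq : h (q c) with
    | none => exact Or.inr ⟨rfl, not_lt.1 h2, rfl⟩
    | some b => exact Or.inl b.2

theorem lineMap_minRep (hX : IsLeader X x) (hkx : k ≤ x) (hx : k' ≤ x) (hq : h (q x) = none)
    (c : ℕ) :
    lineMap k' q x g h (minRep X (lineMap k' q x g h c)) = minRep X (lineMap k' q x g h c) := by
  rcases lineMap_lt_or_eq (q := q) (x := x) (g := g) (h := h) c with hc | hc
  · exact lineMap_of_lt ((minRep_le X _).trans_lt hc)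
  · rw [hc.1, minRep_eq_of_isLeader hX, lineMap_self hkx hx hq]

/-- Merging along `lineMap` relates everything below `K` to a number below `k` or to `x`. -/
theorem exists_rel_mergeBelow_lineMap (ha : Agree K X Y) (hX : IsLeader X x) (hkx : k ≤ x)
    (hx : k' ≤ x) (hq : h (q x) = none) (hxK : x < K) {i : ℕ} (hi : minRep Y i < K) :
    ∃ j, (j < k ∨ j = x) ∧ mergeBelow K (X.comap (lineMap k' q x g h)) Y i j := by
  have hl := ha.symm.isLeader hi (isLeader_minRep Y i)
  have hlt := lineMap_lt_or_eq (q := q) (x := x) (g := g) (h := h) (minRep Y i)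
  refine ⟨lineMap k' q x g h (minRep Y i), hlt.imp_right (·.1), ?_⟩
  refine Setoid.trans' _ (le_mergeBelow K _ Y (rel_minRep Y i))
    (mergeBelow_comap_rel ha hi hl ?_ (lineMap_minRep hX hkx hx hq _))
  rcases hlt with h' | h' <;> omega

/-- If `x` is the least leader on which the word `h` is variable, merging along `lineMap` makes
`x` the first leader beyond `k`. -/
theorem isNext_mergeBelow_lineMap (ha : Agree K X Y) (hX : IsLeader X x) (hkx : k ≤ x)
    (hx : k' ≤ x) (hq : h (q x) = none) (hxK : x < K)
    (hmin : ∀ c < x, IsLeader X c → k' ≤ c → h (q c) ≠ none) :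
    IsNext k (mergeBelow K (X.comap (lineMap k' q x g h)) Y) x := by
  have hlead : IsLeader (mergeBelow K (X.comap (lineMap k' q x g h)) Y) x := by
    intro i hi hr
    rw [mergeBelow_comap_apply ha (by omega) hxK, minRep_eq_of_isLeader hX,
      lineMap_self hkx hx hq] at hr
    have hmi := minRep_le X i
    rcases lineMap_lt_or_eq (q := q) (x := x) (g := g) (h := h) (minRep X i) with hc | hc
    · exact hX _ (hc.trans_le hkx) hr
    · exact hmin _ (by omega) (isLeader_minRep X i) hc.2.1 hc.2.2
  refine ⟨hkx, hlead, fun i hi => ?_⟩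
  obtain ⟨j, hj | rfl, hr⟩ := exists_rel_mergeBelow_lineMap (g := g) ha hX hkx hx hq hxK
    (i := i) ((minRep_le Y i).trans_lt (hi.trans hxK))
  · exact ⟨j, hj, hr⟩
  · exact absurd hr (hlead i hi)

end lineMap

theorem ext_mergeBelow_wordMap (hA : GameFam A) {ι : Type*} (q : ℕ → ι) (a : ι → Fin k)
    (hK : k' ≤ K) (hY : Ext A K X Y) :
    Ext A k' X (mergeBelow K (X.comap (wordMap k' q a)) Y) :=
  ext_mergeBelow_comap hA hY hK fun _ hc => if_pos hc

theorem mergeBelow_wordMap_rel {ι : Type*} (q : ℕ → ι) (a : ι → Fin k)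
    (hk : k ≤ k') (ha : Agree K X Y) {c : ℕ} (hc : c < K) (hkc : k' ≤ c)
    (hl : IsLeader X c) : mergeBelow K (X.comap (wordMap k' q a)) Y c (a (q c)) := by
  have hw : wordMap k' q a c = a (q c) := if_neg (by omega)
  have hlt := (a (q c)).2
  have hle := minRep_le X (a (q c))
  have := mergeBelow_comap_rel ha (ρ := wordMap k' q a) hc hl (by rw [hw]; omega)
    (by rw [hw]; exact if_pos (by omega))
  rwa [hw] at this

theorem isNext_mergeBelow_wordMap {ι : Type*} (q : ℕ → ι) (a : ι → Fin k)
    (hk : k ≤ k') (hK : k' ≤ K) (ha : Agree K X Y) (hn : IsNext K Y n) :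
    IsNext k' (mergeBelow K (X.comap (wordMap k' q a)) Y) n := by
  refine ⟨hK.trans hn.1, hn.2.1.mergeBelow hn.1 _, fun i hi => ?_⟩
  have hc := hn.minRep_lt hi
  have hic := le_mergeBelow K (X.comap (wordMap k' q a)) Y (rel_minRep Y i)
  rcases lt_or_ge (minRep Y i) k' with h | h
  · exact ⟨_, h, hic⟩
  · exact ⟨_, (a (q (minRep Y i))).2.trans_le hk, Setoid.trans' _ hic
      (mergeBelow_wordMap_rel q a hk ha hc h (ha.symm.isLeader hc (isLeader_minRep Y i)))⟩

/-- Given a monochromatic line in a Hales–Jewett cube, all extensions of the corresponding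
merged partition with next leader `n` satisfy `D n`. -/
theorem exists_allExt_lineMap (hA : GameFam A) (hD : Inv A D) {ι : Type*}
    (hJ : ∀ C : (ι → Fin k) → (Fin k' → Fin k), ∃ l : Combinatorics.Line (Fin k) ι, l.IsMono C)
    (q : ℕ → ι) (hk : k ≤ k') (hK : k' ≤ K)
    (hsome : ∀ Y n, Ext A k' X Y → IsNext k' Y n → SomeExt A k D n Y)
    (hY : Ext A K X Y) (hn : IsNext K Y n) :
    ∃ (g : Fin k' → Fin k) (h : ι → Option (Fin k)), (∃ i, h i = none) ∧
      ∀ x, k' ≤ x → x < K → IsLeader X x → h (q x) = none →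
        AllExt A k D n (mergeBelow K (X.comap (lineMap k' q x g h)) Y) := by
  have hext := fun a : ι → Fin k => ext_mergeBelow_wordMap hA q a hK hY
  choose U hU hUn hUD using fun a => hsome _ n (hext a)
    (isNext_mergeBelow_wordMap q a hk hK hY.2.2 hn)
  choose gv hgv hgr using fun a (i : Fin k') => (hUn a).2.2 i (i.2.trans_le (hK.trans hn.1))
  obtain ⟨l, g, hl⟩ := hJ fun a i => ⟨gv a i, hgv a i⟩
  refine ⟨g, l.idxFun, l.proper, fun x hx hxK hX hq Z hZ hZn => ?_⟩
  have hV := ext_mergeBelow_comap hA (ρ := lineMap k' q x g l.idxFun) hY (hk.trans hK)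
    fun c hc => lineMap_of_lt hc
  obtain ⟨b, hb, hxb⟩ := hZn.2.2 x (hxK.trans_le hn.1)
  set a := l ⟨b, hb⟩ with hadef
  have hXU : Ext A k X (U a) := ((hext a).of_le hk).trans (hU a)
  have hag : Agree k (U a) Z := hXU.2.2.symm.trans (hV.2.2.trans hZ.2.2)
  have hline : ∀ c < K, IsLeader X c → Z c (lineMap k' q x g l.idxFun c) := by
    intro c hc hXc
    refine hZ.2.1 (mergeBelow_comap_rel hY.2.2 hc hXc ?_
      (lineMap_minRep hX (hk.trans hx) hx hq c))
    rcases lineMap_lt_or_eq (q := q) (x := x) (g := g) (h := l.idxFun) c with h' | h' <;> omega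
  refine hD n _ (hU a).1 Z hZ.1 (hUn a).2.1 hZn.2.1 (hag.of_reps fun i hi => ?_) (hUD a)
  have hc := hn.minRep_lt hi
  have hXc := hY.2.2.symm.isLeader hc (isLeader_minRep Y i)
  have hic := rel_minRep Y i
  have hZc := hZ.2.1 (le_mergeBelow K _ Y hic)
  have hUc := (hU a).2.1 (le_mergeBelow K _ Y hic)
  suffices ∃ j < k, U a (minRep Y i) j ∧ Z (minRep Y i) j by
    obtain ⟨j, hj, h1, h2⟩ := this
    exact ⟨j, hj, Setoid.trans' _ hUc h1, Setoid.trans' _ hZc h2⟩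
  have hZl := hline _ hc hXc
  revert hc hXc hZl
  generalize minRep Y i = c
  intro hc hXc hZl
  rcases lt_or_ge c k with h1 | h1
  · exact ⟨c, h1, Setoid.refl' _ c, Setoid.refl' _ c⟩
  rcases lt_or_ge c k' with h2 | h2
  · rw [lineMap, if_neg (not_lt.2 h1), dif_pos h2] at hZl
    refine ⟨g ⟨c, h2⟩, (g _).2, ?_, hZl⟩
    rw [← hl ⟨b, hb⟩]
    exact hgr a ⟨c, h2⟩
  · rw [lineMap, if_neg (not_lt.2 h1), dif_neg (not_lt.2 h2)] at hZl
    have hw := (hU a).2.1 (mergeBelow_wordMap_rel q a hk hY.2.2 hc h2 hXc)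
    rw [hadef, Combinatorics.Line.coe_apply] at hw
    refine ⟨((l.idxFun (q c)).getD ⟨b, hb⟩ : Fin k), Fin.is_lt _, hw, ?_⟩
    cases hqc : l.idxFun (q c) with
    | none =>
      rw [hqc] at hZl
      exact Setoid.trans' _ hZl hxb
    | some b' =>
      rw [hqc] at hZl
      exact hZl

/-- Infinitely many leaders can be distributed over a finite index set. -/
theorem GameFam.exists_surjection_leaders (hA : GameFam A) (hX : X ∈ A) (k : ℕ) (ι : Type*)
    [Finite ι] [Nonempty ι] :
    ∃ (q : ℕ → ι) (K : ℕ), k ≤ K ∧ ∀ i, ∃ c, k ≤ c ∧ c < K ∧ IsLeader X c ∧ q c = i := by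
  classical
  have hinf : {c | k ≤ c ∧ IsLeader X c}.Infinite :=
    Set.infinite_of_forall_exists_gt fun m => by
      obtain ⟨n, hn, hl⟩ := hA.exists_isLeader X hX (max (m + 1) k)
      exact ⟨n, ⟨(le_max_right _ _).trans hn, hl⟩, (le_max_left _ _).trans hn⟩
  obtain ⟨m, ⟨f⟩⟩ := Finite.exists_equiv_fin ι
  let e : ι → ℕ := fun i => (hinf.natEmbedding _ (f i : ℕ) : ℕ)
  have he : Function.Injective e := fun i j hij => by
    apply f.injective
    apply Fin.ext
    exact (hinf.natEmbedding _).injective (Subtype.ext hij)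
  obtain ⟨B, hB⟩ := (Set.finite_range e).bddAbove
  refine ⟨Function.invFun e, max k (B + 1), le_max_left _ _, fun i => ⟨e i, ?_, ?_, ?_, ?_⟩⟩
  · exact (hinf.natEmbedding _ (f i : ℕ)).2.1
  · exact lt_of_lt_of_le (Nat.lt_succ_of_le (hB ⟨i, rfl⟩)) (le_max_right _ _)
  · exact (hinf.natEmbedding _ (f i : ℕ)).2.2
  · exact Function.leftInverse_invFun he i

theorem Dense.exists_dense_allExt (hA : GameFam A) (hD : Inv A D) (hk0 : 0 < k) (hX : X ∈ A)
    (h : Dense A k D X) :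
    ∃ Y n, Ext A k X Y ∧ IsNext k Y n ∧ Dense A (n + 1) (AllExt A k D) Y := by
  classical
  obtain ⟨k', X', hk, hX', hsome⟩ := h.exists_someExt hA hX
  obtain ⟨ι, _, hJ⟩ :=
    Combinatorics.Line.exists_mono_in_high_dimension (Fin k) (Fin k' → Fin k)
  suffices hmain : ∃ Y n, Ext A k X' Y ∧ IsNext k Y n ∧ Dense A (n + 1) (AllExt A k D) Y by
    obtain ⟨Y, n, hY, hn⟩ := hmain
    exact ⟨Y, n, hX'.trans hY, hn⟩
  have : Nonempty ι := by
    obtain ⟨l, -⟩ := hJ fun _ _ => ⟨0, hk0⟩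
    exact l.proper.nonempty
  obtain ⟨q, K, hK, hq⟩ := hA.exists_surjection_leaders hX'.1 k' ι
  let Φ := (Fin k' → Fin k) × {h : ι → Option (Fin k) // ∃ i, h i = none}
  have hvar : ∀ φ : Φ, ∃ x, k' ≤ x ∧ x < K ∧ IsLeader X' x ∧ φ.2.1 (q x) = none ∧
      ∀ c < x, IsLeader X' c → k' ≤ c → φ.2.1 (q c) ≠ none := by
    rintro ⟨-, v, i, hi⟩
    have hex : ∃ c, k' ≤ c ∧ IsLeader X' c ∧ v (q c) = none := by
      obtain ⟨c, hc, -, hl, rfl⟩ := hq i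
      exact ⟨c, hc, hl, hi⟩
    refine ⟨Nat.find hex, (Nat.find_spec hex).1, ?_, (Nat.find_spec hex).2.1,
      (Nat.find_spec hex).2.2, fun c hc hl hkc hv => Nat.find_min hex hc ⟨hkc, hl, hv⟩⟩
    obtain ⟨c, hc, hcK, hl, rfl⟩ := hq i
    exact (Nat.find_min' hex ⟨hc, hl, hi⟩).trans_lt hcK
  choose x hx hxK hxl hxv hxmin using hvar
  let merge : Φ → Setoid ℕ → Setoid ℕ := fun φ Y =>
    mergeBelow K (X'.comap (lineMap k' q (x φ) φ.1 φ.2.1)) Y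
  have hrel : ∀ φ Y i, Ext A K X' Y → minRep Y i < K → ∃ j < x φ + 1, merge φ Y i j := by
    intro φ Y i hY hi
    obtain ⟨j, hj, hr⟩ := exists_rel_mergeBelow_lineMap (g := φ.1) hY.2.2 (hxl φ)
      (hk.trans (hx φ)) (hx φ) (hxv φ) (hxK φ) hi
    have := hx φ
    exact ⟨j, by omega, hr⟩
  by_contra! hno
  obtain ⟨Y, hY, hall⟩ := exists_ext_forall (A := A) (K := K) (X := X')
    (fun (φ : Φ) Y => ∀ Z n, Ext A K Y Z → IsNext K Z n → ¬ AllExt A k D n (merge φ Z))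
    (fun φ Y W hP hYW Z n hZ => hP Z n (hYW.trans hZ)) hX'.1 (by
      intro φ Y hY
      have hbad := hno (merge φ Y) (x φ)
        (ext_mergeBelow_comap hA hY (hk.trans hK) fun c hc => lineMap_of_lt hc)
        (isNext_mergeBelow_lineMap hY.2.2 (hxl φ) (hk.trans (hx φ)) (hx φ) (hxv φ) (hxK φ)
          (hxmin φ))
      unfold Dense at hbad
      push Not at hbad
      obtain ⟨W, hW, hWbad⟩ := hbad
      have hYW : Y ≤ W := (le_mergeBelow K _ Y).trans hW.2.1
      have hS := hA.splitBelow_ext K hYW hW.1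
      have hagW : Agree K (merge φ Y) W := hW.2.2.of_reps fun i hi => by
        obtain ⟨j, hj, hr⟩ := hrel φ Y i hY ((minRep_le Y i).trans_lt hi)
        exact ⟨j, hj, hr, hW.2.1 hr⟩
      refine ⟨splitBelow K Y W, hS, fun Z n hZ hn => ?_⟩
      have hYZ := hS.trans hZ
      have hagZ : Agree K (merge φ Y) (merge φ Z) := hYZ.2.2.mergeBelow _
      have hxK' := hxK φ
      refine hWbad (merge φ Z) n ⟨hA.mergeBelow_mem _ K hZ.1, ?_, ?_⟩
        ⟨?_, hn.2.1.mergeBelow hn.1 _, fun i hi => hrel φ Z i (hY.trans hYZ) (hn.minRep_lt hi)⟩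
      · refine (le_mergeBelow_splitBelow hYW fun i hi j hj hij => ?_).trans
          (mergeBelow_mono _ hZ.2.1 hZ.2.2)
        rw [← mergeBelow_apply_of_lt hi hj]
        exact (hagW i hi j hj).2 hij
      · exact (hagW.symm.trans hagZ).of_le hxK'
      · have := hn.1
        omega)
  obtain ⟨n, hn⟩ := hA.exists_isNext hY.1 K
  obtain ⟨g, v, hv, hgv⟩ := exists_allExt_lineMap hA hD hJ q hk hK hsome hY hn
  exact hall (g, ⟨v, hv⟩) Y n (Ext.refl K hY.1) hn
    (hgv _ (hx _) (hxK _) (hxl _) (hxv (g, ⟨v, hv⟩)))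

theorem Dense.of_allExt_allExt (hA : GameFam A) (hk : k ≤ k') (hK : k' ≤ K)
    (h : Dense A K (AllExt A k' (AllExt A k D)) X) : Dense A K (AllExt A k D) X := by
  intro Y hY
  obtain ⟨Z, n, hZ, hn, hall⟩ := h Y hY
  exact ⟨Z, n, hZ, hn, hall.of_allExt hA hk (hK.trans hn.1)⟩

theorem Dense.allExt (hD : Inv A D) (h : Dense A k D X) : Dense A k (AllExt A k D) X := by
  intro Y hY
  obtain ⟨Z, n, hZ, hn, hDn⟩ := h Y hY
  exact ⟨Z, n, hZ, hn, hD.allExt_of_isNext hZ.1 hn hDn⟩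

/-- Density of `AllExt A k D` passes to coarser partitions with the same stem of length `k`. -/
theorem Dense.allExt_of_ext (hA : GameFam A) (hk : k ≤ K) (h : Dense A K (AllExt A k D) Y)
    (hZ : Ext A k Y Z) : Dense A K (AllExt A k D) Z := by
  intro W hW
  have hYW : Y ≤ W := hZ.2.1.trans hW.2.1
  have hS := hA.splitBelow_ext K hYW hW.1
  obtain ⟨V, m, hV, hm, hall⟩ := h _ hS
  have hYV := hS.trans hV
  have hWV : W ≤ mergeBelow K Z V :=
    (le_mergeBelow_splitBelow hYW fun i hi j hj hij => Z.trans'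
      (Z.symm' (hZ.2.1 (rel_minRep Y i)))
      (Z.trans' ((hW.2.2 i hi j hj).2 hij) (hZ.2.1 (rel_minRep Y j)))).trans
      (mergeBelow_mono _ hV.2.1 hV.2.2)
  have hag : Agree K (mergeBelow K Z V) Z := agree_mergeBelow_self hYV.2.2.symm hZ.2.1
  have hmem := hA.mergeBelow_mem Z K hYV.1
  refine ⟨mergeBelow K Z V, m, ⟨hmem, hWV, hW.2.2.symm.trans hag.symm⟩,
    ⟨hm.1, hm.2.1.mergeBelow hm.1 Z, fun i hi => ?_⟩, hall.of_ext
      ⟨hmem, le_mergeBelow K Z V, ((hYV.2.2.of_le hk).symm.trans hZ.2.2).trans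
        (hag.symm.of_le hk)⟩⟩
  obtain ⟨j, hj, hr⟩ := hm.2.2 i hi
  exact ⟨j, hj, le_mergeBelow K Z V hr⟩

theorem Dense.exists_isNext_dense_allExt (hA : GameFam A) (hD : Inv A D) (hk0 : 0 < k)
    (hX : X ∈ A) (h : Dense A k D X) :
    ∃ Y n, Ext A k X Y ∧ IsNext k Y n ∧ D n Y ∧ Dense A (n + 1) (AllExt A k D) Y := by
  obtain ⟨Y, hY, hlead⟩ := hA.game
    (fun k' X' => Ext A k X X' ∧ k ≤ k' ∧ Dense A k' (AllExt A k D) X') k X hX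
    ⟨Ext.refl k hX, le_rfl, h.allExt hD⟩ (by
      rintro k' X' ⟨hX', hk, hd⟩ X'' hX''
      obtain ⟨Y, n, hY, hn, hdn⟩ := (hd.of_ext hX'').exists_dense_allExt hA (hD.allExt hA k)
        (hk0.trans_le hk) hX''.1
      have hkn := hn.1
      exact ⟨Y, n, hY, hn, hX'.trans ((hX''.trans hY).of_le hk), by omega,
        hdn.of_allExt_allExt hA hk (by omega)⟩)
  obtain ⟨Z, n, hZ, hn, hDn⟩ := h Y hY
  obtain ⟨W, hW, -, hkn, hd⟩ := hlead n hn.1 (hn.2.1.mono hZ.2.1)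
  exact ⟨Z, n, hY.trans hZ, hn, hDn, (hd.of_ext hW).allExt_of_ext hA hkn hZ⟩

/-- A dense property holds everywhere below some extension. -/
theorem Dense.exists_forall (hA : GameFam A) (hD : Inv A D) (hk0 : 0 < k) (hX : X ∈ A)
    (h : Dense A k D X) : ∃ Y, Ext A k X Y ∧ ∀ Z n, Ext A k Y Z → IsNext k Z n → D n Z := by
  obtain ⟨Y, hY, hlead⟩ := hA.game
    (fun k' X' => Ext A k X X' ∧ k ≤ k' ∧ Dense A k' (AllExt A k D) X' ∧
      (k' = k ∨ AllExt A k D (k' - 1) X')) k X hX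
    ⟨Ext.refl k hX, le_rfl, h.allExt hD, Or.inl rfl⟩ (by
      rintro k' X' ⟨hX', hk, hd, -⟩ X'' hX''
      obtain ⟨Y, n, hY, hn, hall, hdn⟩ := (hd.of_ext hX'').exists_isNext_dense_allExt hA
        (hD.allExt hA k) (hk0.trans_le hk) hX''.1
      have hkn := hn.1
      exact ⟨Y, n, hY, hn, hX'.trans ((hX''.trans hY).of_le hk), by omega,
        hdn.of_allExt_allExt hA hk (by omega), Or.inr hall⟩)
  refine ⟨Y, hY, fun Z n hZ hn => ?_⟩
  obtain ⟨W, hW, -, -, -, hs⟩ := hlead n hn.1 (hn.2.1.mono hZ.2.1)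
  have hkn := hn.1
  rcases hs with hs | hs
  · omega
  · exact hs Z ((hW.of_le (by omega)).trans hZ) hn

/-- Send every number in `[k, K)` to a number below `k` via `f`. -/
def stemMap (f : Fin K → Fin k) (c : ℕ) : ℕ :=
  if c < k then c else if hc : c < K then f ⟨c, hc⟩ else c

theorem stemMap_of_lt {f : Fin K → Fin k} {c : ℕ} (hc : c < k) : stemMap f c = c := if_pos hc

theorem stemMap_lt (f : Fin K → Fin k) {c : ℕ} (hc : c < K) : stemMap f c < k := by
  unfold stemMap
  split_ifs with h
  · exact h
  · exact (f _).2

theorem exists_rel_mergeBelow_stemMap (f : Fin K → Fin k) (hk : k ≤ K) (ha : Agree K Z Y)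
    {i : ℕ} (hi : i < K) : ∃ j < k, mergeBelow K (Z.comap (stemMap f)) Y i j := by
  have hi' := (minRep_le Y i).trans_lt hi
  have hlt := stemMap_lt f hi'
  refine ⟨_, hlt, Setoid.trans' _ (le_mergeBelow K _ Y (rel_minRep Y i))
    (mergeBelow_comap_rel ha hi' (ha.symm.isLeader hi' (isLeader_minRep Y i))
      (hlt.trans_le hk) (stemMap_of_lt ((minRep_le Z _).trans_lt hlt)))⟩

theorem Dense.mergeBelow_stemMap (hA : GameFam A) (hD : Inv A D) (h : Dense A k D Z)
    (hk : k ≤ K) (f : Fin K → Fin k) :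
    Dense A K (fun n Y => K ≤ n → D n (mergeBelow K (Z.comap (stemMap f)) Y)) Z := by
  intro Y hY
  have hV := ext_mergeBelow_comap hA (ρ := stemMap f) hY hk fun c hc => stemMap_of_lt hc
  obtain ⟨V, n, hVV, hn, hDn⟩ := h _ hV
  have hYV : Y ≤ V := (le_mergeBelow K _ Y).trans hVV.2.1
  have hreps : ∀ i < K, ∃ j < k, mergeBelow K (Z.comap (stemMap f)) Y i j ∧ V i j := by
    intro i hi
    obtain ⟨j, hj, hr⟩ := exists_rel_mergeBelow_stemMap f hk hY.2.2 hi
    exact ⟨j, hj, hr, hVV.2.1 hr⟩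
  have hag : Agree K _ V := hVV.2.2.of_reps hreps
  have hKn : K ≤ n := by
    by_contra hlt
    obtain ⟨j, hj, -, hr⟩ := hreps n (not_le.1 hlt)
    exact hn.2.1 j (hj.trans_le hn.1) (V.symm' hr)
  have hS := hA.splitBelow_ext K hYV hVV.1
  have hle := splitBelow_le (K := K) hYV
  have hSn : IsNext K (splitBelow K Y V) n := ⟨hKn, hn.2.1.mono hle, fun i hi =>
    exists_splitBelow_rel hYV ((hn.minRep_lt hi).trans_le hk)⟩
  refine ⟨splitBelow K Y V, n, hS, hSn, fun _ => ?_⟩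
  have hZS := ext_mergeBelow_comap hA (ρ := stemMap f) (hY.trans hS) hk
    fun c hc => stemMap_of_lt hc
  refine hD n V hVV.1 _ hZS.1 hn.2.1 (hSn.2.1.mergeBelow hKn _) (hn.agree ?_ ?_) hDn
  · refine le_mergeBelow_splitBelow hYV fun i hi j hj hij => ?_
    rw [← mergeBelow_apply_of_lt hi hj]
    exact (hag i hi j hj).2 hij
  · exact (hV.2.2.trans hVV.2.2).symm.trans hZS.2.2

/-- If `D` is dense over the stem of length `k`, then some extension of `Z` over a longer stem
of length `K` has the property that all its extensions over the shorter stem satisfy `D`. -/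
theorem Dense.exists_forall_stem (hA : GameFam A) (hD : Inv A D) (hk0 : 0 < k) (hk : k ≤ K)
    (hZ : Z ∈ A) (h : Dense A k D Z) :
    ∃ Y, Ext A K Z Y ∧ ∀ W n, Ext A k Y W → IsNext k W n → K ≤ n → D n W := by
  have hInv : ∀ f : Fin K → Fin k,
      Inv A (fun n Y => K ≤ n → D n (mergeBelow K (Z.comap (stemMap f)) Y)) := by
    intro f n Y hY W hW hYn hWn ha hDn hKn
    exact hD n _ (hA.mergeBelow_mem _ K hY) _ (hA.mergeBelow_mem _ K hW)
      (hYn.mergeBelow hKn _) (hWn.mergeBelow hKn _) (ha.mergeBelow _) (hDn hKn)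
  obtain ⟨Y, hY, hall⟩ := exists_ext_forall (A := A) (K := K) (X := Z)
    (fun (f : Fin K → Fin k) Y => ∀ W n, Ext A K Y W → IsNext K W n → K ≤ n →
      D n (mergeBelow K (Z.comap (stemMap f)) W))
    (fun f Y W hP hYW V n hV => hP V n (hYW.trans hV)) hZ
    (fun f Y hY => ((h.mergeBelow_stemMap hA hD hk f).of_ext hY).exists_forall hA (hInv f)
      (hk0.trans_le hk) hY.1)
  refine ⟨Y, hY, fun W n hW hn hKn => ?_⟩
  choose fv hfv hfr using fun i : Fin K => hn.2.2 i (i.2.trans_le hKn)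
  have hS := hA.splitBelow_ext K hW.2.1 hW.1
  have hle := splitBelow_le (K := K) hW.2.1
  have hSn : IsNext K (splitBelow K Y W) n := ⟨hKn, hn.2.1.mono hle, fun i hi =>
    exists_splitBelow_rel hW.2.1 ((hn.minRep_lt hi).trans_le hk)⟩
  let f : Fin K → Fin k := fun i => ⟨fv i, hfv i⟩
  have hDn := hall f _ n hS hSn hKn
  have hZS := ext_mergeBelow_comap hA (ρ := stemMap f) (hY.trans hS) hk
    fun c hc => stemMap_of_lt hc
  have hZW : Ext A k Z W := (hY.of_le hk).trans hW
  refine hD n _ hZS.1 W hW.1 (hSn.2.1.mergeBelow hKn _) hn.2.1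
    (hn.agree ?_ (hZW.2.2.symm.trans hZS.2.2)).symm hDn
  refine le_mergeBelow_splitBelow hW.2.1 fun i hi j hj hij => ?_
  have key : ∀ i < K, W i (stemMap f (minRep Y i)) := by
    intro i hi
    have hc := (minRep_le Y i).trans_lt hi
    refine W.trans' (hW.2.1 (rel_minRep Y i)) ?_
    unfold stemMap
    split_ifs
    · exact W.refl' _
    · exact hfr ⟨_, hc⟩
  exact (hZW.2.2 _ (stemMap_lt f ((minRep_le Y i).trans_lt hi)) _
    (stemMap_lt f ((minRep_le Y j).trans_lt hj))).2
    (W.trans' (W.symm' (key i hi)) (W.trans' hij (key j hj)))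

end GameFam

/-! ### Partitions in terms of the relation of lying in a common block -/

section Translation

variable {P Q : Set (Set ℕ)} {Y Z : Setoid ℕ} {i j k n : ℕ}

theorem IsPartition.eq_of_mem (hP : IsPartition P) {p q : Set ℕ} (hp : p ∈ P) (hq : q ∈ P)
    (hip : i ∈ p) (hiq : i ∈ q) : p = q := by
  by_contra h
  exact Set.disjoint_left.1 (hP.2 p hp q hq h) hip hiq

theorem sameBlock_self_iff : sameBlock P i i ↔ i ∈ pdom P := by
  simp [sameBlock, pdom]

theorem sameBlock.symm (h : sameBlock P i j) : sameBlock P j i :=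
  let ⟨p, hp, hi, hj⟩ := h
  ⟨p, hp, hj, hi⟩

theorem sameBlock.mem_left (h : sameBlock P i j) : i ∈ pdom P :=
  let ⟨p, hp, hi, _⟩ := h
  ⟨p, hp, hi⟩

theorem IsPartition.sameBlock_iff (hP : IsPartition P) {p : Set ℕ} (hp : p ∈ P) (hi : i ∈ p) :
    sameBlock P i j ↔ j ∈ p := by
  constructor
  · rintro ⟨q, hq, hiq, hjq⟩
    rwa [hP.eq_of_mem hp hq hi hiq]
  · exact fun hj => ⟨p, hp, hi, hj⟩

theorem IsPartition.subset (hP : IsPartition P) (hQ : IsPartition Q)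
    (h : ∀ i j, sameBlock P i j ↔ sameBlock Q i j) : P ⊆ Q := by
  intro p hp
  obtain ⟨i, hi⟩ := hP.1 p hp
  obtain ⟨q, hq, hiq, -⟩ := (h i i).1 ⟨p, hp, hi, hi⟩
  have : p = q := by
    ext j
    rw [← hP.sameBlock_iff hp hi, h, hQ.sameBlock_iff hq hiq]
  rwa [this]

theorem IsPartition.ext (hP : IsPartition P) (hQ : IsPartition Q)
    (h : ∀ i j, sameBlock P i j ↔ sameBlock Q i j) : P = Q :=
  (hP.subset hQ h).antisymm (hQ.subset hP fun i j => (h i j).symm)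

theorem segment_iff (hP : IsPartition P) (hQ : IsPartition Q) (hdom : pdom P ⊆ pdom Q) :
    Segment P Q ↔ ∀ i ∈ pdom P, ∀ j ∈ pdom P, (sameBlock P i j ↔ sameBlock Q i j) := by
  constructor
  · rintro h i ⟨p, hp, hi⟩ j hj
    obtain ⟨q, hq, hpq⟩ := h p hp
    have hiq : i ∈ q := (hpq ▸ hi : i ∈ q ∩ pdom P).1
    rw [hP.sameBlock_iff hp hi, hQ.sameBlock_iff hq hiq, hpq]
    exact ⟨fun h => h.1, fun h => ⟨h, hj⟩⟩
  · intro h p hp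
    obtain ⟨i, hi⟩ := hP.1 p hp
    have hid : i ∈ pdom P := ⟨p, hp, hi⟩
    obtain ⟨q, hq, hiq⟩ := hdom hid
    refine ⟨q, hq, ?_⟩
    ext j
    constructor
    · intro hj
      have hjd : j ∈ pdom P := ⟨p, hp, hj⟩
      exact ⟨(hQ.sameBlock_iff hq hiq).1 ((h i hid j hjd).1 ⟨p, hp, hi, hj⟩), hjd⟩
    · rintro ⟨hj, hjd⟩
      exact (hP.sameBlock_iff hp hi).1 ((h i hid j hjd).2 ⟨q, hq, hiq, hj⟩)

theorem coarser_iff (hP : IsPartition P) (hQ : IsPartition Q) :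
    Coarser P Q ↔ ∀ i ∈ pdom P, ∀ j ∈ pdom P, sameBlock Q i j → sameBlock P i j := by
  constructor
  · rintro h i ⟨p, hp, hi⟩ j hj ⟨q, hq, hiq, hjq⟩
    obtain ⟨S, hS, hpS⟩ := h p hp
    have hi' : i ∈ ⋃ q ∈ S, q ∩ pdom P := hpS ▸ ⟨hi, ⟨q, hq, hiq⟩⟩
    simp only [Set.mem_iUnion] at hi'
    obtain ⟨q', hq', hiq'⟩ := hi'
    obtain rfl := hQ.eq_of_mem hq (hS hq') hiq hiq'.1
    have hj' : j ∈ ⋃ q ∈ S, q ∩ pdom P := by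
      simp only [Set.mem_iUnion]
      exact ⟨q, hq', hjq, hj⟩
    exact ⟨p, hp, hi, (hpS ▸ hj' : j ∈ p ∩ pdom Q).1⟩
  · intro h p hp
    refine ⟨{q ∈ Q | (q ∩ p).Nonempty}, fun q hq => hq.1, ?_⟩
    ext j
    simp only [Set.mem_iUnion]
    constructor
    · rintro ⟨hj, q, hq, hjq⟩
      exact ⟨q, ⟨hq, j, hjq, hj⟩, hjq, p, hp, hj⟩
    · rintro ⟨q, ⟨hq, i, hiq, hip⟩, hjq, hj⟩
      exact ⟨(hP.sameBlock_iff hp hip).1 (h i ⟨p, hp, hip⟩ j hj ⟨q, hq, hiq, hjq⟩), q, hq, hjq⟩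

/-- The setoid whose classes are the blocks of `P` and the singletons outside its domain. -/
def setoidOf (hP : IsPartition P) : Setoid ℕ where
  r i j := i = j ∨ sameBlock P i j
  iseqv :=
    { refl := fun _ => Or.inl rfl
      symm := fun h => h.imp Eq.symm sameBlock.symm
      trans := by
        rintro i j l (rfl | ⟨p, hp, hi, hj⟩) (rfl | h)
        · exact Or.inl rfl
        · exact Or.inr h
        · exact Or.inr ⟨p, hp, hi, hj⟩
        · exact Or.inr ⟨p, hp, hi, (hP.sameBlock_iff hp hj).1 h⟩ }

theorem setoidOf_apply (hP : IsPartition P) (hi : i ∈ pdom P) :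
    setoidOf hP i j ↔ sameBlock P i j :=
  ⟨fun h => h.elim (fun e => e ▸ sameBlock_self_iff.2 hi) id, Or.inr⟩

theorem isPartition_classes (Y : Setoid ℕ) : IsPartition Y.classes := by
  constructor
  · rintro b ⟨i, rfl⟩
    exact ⟨i, Y.refl' i⟩
  · rintro b ⟨i, rfl⟩ c ⟨j, rfl⟩ hne
    refine Set.disjoint_left.2 fun l hi hj => hne ?_
    ext m
    exact ⟨fun h => Y.trans' h (Y.trans' (Y.symm' hi) hj),
      fun h => Y.trans' h (Y.trans' (Y.symm' hj) hi)⟩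

theorem sameBlock_classes : sameBlock Y.classes i j ↔ Y i j := by
  constructor
  · rintro ⟨b, ⟨l, rfl⟩, hi, hj⟩
    exact Y.trans' hi (Y.symm' hj)
  · exact fun h => ⟨_, ⟨j, rfl⟩, h, Y.refl' j⟩

theorem pdom_classes (Y : Setoid ℕ) : pdom Y.classes = Set.univ :=
  Set.eq_univ_of_forall fun i => sameBlock_self_iff.1 (sameBlock_classes.2 (Y.refl' i))

theorem classes_setoidOf (hP : IsPartition P) (hdom : pdom P = Set.univ) :
    (setoidOf hP).classes = P :=
  (isPartition_classes _).ext hP fun i j => by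
    rw [sameBlock_classes, setoidOf_apply hP (hdom ▸ Set.mem_univ i)]

theorem coarser_classes : Coarser Z.classes Y.classes ↔ Y ≤ Z := by
  rw [coarser_iff (isPartition_classes Z) (isPartition_classes Y)]
  simp only [pdom_classes, sameBlock_classes, Set.mem_univ, forall_const]
  exact ⟨fun h i j hij => h i j hij, fun h i j hij => h hij⟩

theorem classes_infinite_iff : Y.classes.Infinite ↔ ∀ k, ∃ n ≥ k, IsLeader Y n := by
  have himage : Y.classes = (fun n => {i | Y i n}) '' {n | IsLeader Y n} := by
    ext b
    constructor
    · rintro ⟨i, rfl⟩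
      refine ⟨minRep Y i, isLeader_minRep Y i, ?_⟩
      ext l
      exact ⟨fun h => Y.trans' h (Y.symm' (rel_minRep Y i)), fun h => Y.trans' h (rel_minRep Y i)⟩
    · rintro ⟨i, -, rfl⟩
      exact ⟨i, rfl⟩
  have hinj : Set.InjOn (fun n => {i | Y i n}) {n | IsLeader Y n} := by
    intro a ha b hb hab
    have h : Y a b := (Set.ext_iff.1 hab a).1 (Y.refl' a)
    rw [← minRep_eq_of_isLeader ha, ← minRep_eq_of_isLeader hb]
    exact minRep_eq_iff.2 h
  rw [himage, Set.infinite_image_iff hinj]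
  constructor
  · intro h k
    obtain ⟨n, hn, hk⟩ := h.exists_gt k
    exact ⟨n, hk.le, hn⟩
  · refine fun h => Set.infinite_of_forall_exists_gt fun k => ?_
    obtain ⟨n, hn, hl⟩ := h (k + 1)
    exact ⟨n, hl, hn⟩

theorem infPart_classes : InfPart Y.classes ↔ ∀ k, ∃ n ≥ k, IsLeader Y n :=
  ⟨fun h => classes_infinite_iff.1 h.2.2,
    fun h => ⟨isPartition_classes Y, pdom_classes Y, classes_infinite_iff.2 h⟩⟩

/-- The restriction of the partition given by `Y` to `{0, …, n - 1}`. -/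
def restr (n : ℕ) (Y : Setoid ℕ) : Set (Set ℕ) := {b | ∃ i < n, b = {j | j < n ∧ Y j i}}

theorem isPartition_restr (n : ℕ) (Y : Setoid ℕ) : IsPartition (restr n Y) := by
  constructor
  · rintro b ⟨i, hi, rfl⟩
    exact ⟨i, hi, Y.refl' i⟩
  · rintro b ⟨i, _, rfl⟩ c ⟨j, _, rfl⟩ hne
    refine Set.disjoint_left.2 fun l hi hj => hne ?_
    ext m
    exact ⟨fun h => ⟨h.1, Y.trans' h.2 (Y.trans' (Y.symm' hi.2) hj.2)⟩,
      fun h => ⟨h.1, Y.trans' h.2 (Y.trans' (Y.symm' hj.2) hi.2)⟩⟩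

theorem sameBlock_restr : sameBlock (restr n Y) i j ↔ i < n ∧ j < n ∧ Y i j := by
  constructor
  · rintro ⟨b, ⟨l, _, rfl⟩, hi, hj⟩
    exact ⟨hi.1, hj.1, Y.trans' hi.2 (Y.symm' hj.2)⟩
  · exact fun h => ⟨_, ⟨j, h.2.1, rfl⟩, ⟨h.1, h.2.2⟩, ⟨h.2.1, Y.refl' j⟩⟩

theorem pdom_restr (n : ℕ) (Y : Setoid ℕ) : pdom (restr n Y) = Set.Iio n := by
  ext i
  rw [← sameBlock_self_iff, sameBlock_restr]
  exact ⟨fun h => h.1, fun h => ⟨h, h, Y.refl' i⟩⟩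

theorem finPart_restr (n : ℕ) (Y : Setoid ℕ) : FinPart (restr n Y) :=
  ⟨isPartition_restr n Y, n, pdom_restr n Y⟩

theorem restr_setoidOf (hP : IsPartition P) (hdom : pdom P = Set.Iio n) :
    restr n (setoidOf hP) = P :=
  (isPartition_restr n _).ext hP fun i j => by
    rw [sameBlock_restr]
    constructor
    · rintro ⟨hi, -, h⟩
      exact (setoidOf_apply hP (hdom ▸ hi)).1 h
    · intro h
      have hi := h.mem_left
      have hj := h.symm.mem_left
      exact ⟨hdom.le hi, hdom.le hj, (setoidOf_apply hP hi).2 h⟩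

theorem finBound_eq (hdom : pdom P = Set.Iio n) : finBound P = n := by
  have : {m | pdom P = Set.Iio m} = {n} := by
    ext m
    rw [hdom]
    exact ⟨fun h => (Set.Iio_injective h).symm, fun h => by rw [h]; rfl⟩
  rw [finBound, this, csInf_singleton]

theorem sStar_restr (h : IsLeader Y n) : sStar (restr n Y) = restr (n + 1) Y := by
  rw [sStar, finBound_eq (pdom_restr n Y)]
  have hlt : ∀ i < n, {j | j < n ∧ Y j i} = {j | j < n + 1 ∧ Y j i} := by
    intro i hi
    ext j
    refine ⟨fun hj => ⟨by have := hj.1; omega, hj.2⟩, fun hj => ⟨?_, hj.2⟩⟩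
    rcases Nat.lt_succ_iff_lt_or_eq.1 hj.1 with h' | rfl
    · exact h'
    · exact absurd (Y.symm' hj.2) (h i hi)
  have hn : {j | j < n + 1 ∧ Y j n} = {n} := by
    ext j
    constructor
    · rintro ⟨hj, hr⟩
      rcases Nat.lt_succ_iff_lt_or_eq.1 hj with h' | rfl
      · exact absurd hr (h j h')
      · rfl
    · rintro rfl
      exact ⟨Nat.lt_succ_self _, Y.refl' _⟩
  ext b
  constructor
  · rintro (rfl | ⟨i, hi, rfl⟩)
    · exact ⟨n, Nat.lt_succ_self n, hn.symm⟩
    · exact ⟨i, by omega, hlt i hi⟩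
  · rintro ⟨i, hi, rfl⟩
    rcases Nat.lt_succ_iff_lt_or_eq.1 hi with h' | rfl
    · exact Or.inr ⟨i, h', (hlt i h').symm⟩
    · exact Or.inl hn

theorem restr_congr (h : Agree n Y Z) : restr n Y = restr n Z :=
  (isPartition_restr n Y).ext (isPartition_restr n Z) fun i j => by
    rw [sameBlock_restr, sameBlock_restr]
    exact ⟨fun ⟨hi, hj, hr⟩ => ⟨hi, hj, (h i hi j hj).1 hr⟩,
      fun ⟨hi, hj, hr⟩ => ⟨hi, hj, (h i hi j hj).2 hr⟩⟩

theorem segment_restr_classes : Segment (restr n Y) Z.classes ↔ Agree n Y Z := by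
  rw [segment_iff (isPartition_restr n Y) (isPartition_classes Z) (by simp [pdom_classes])]
  simp only [pdom_restr, sameBlock_restr, sameBlock_classes, Set.mem_Iio, Agree]
  exact ⟨fun h i hi j hj => by simpa [hi, hj] using h i hi j hj,
    fun h i hi j hj => by simpa [hi, hj] using h i hi j hj⟩

theorem segment_restr_restr (hk : k ≤ n) : Segment (restr k Y) (restr n Z) ↔ Agree k Y Z := by
  rw [segment_iff (isPartition_restr k Y) (isPartition_restr n Z)
    (by simpa [pdom_restr] using hk)]
  simp only [pdom_restr, sameBlock_restr, Set.mem_Iio, Agree]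
  exact ⟨fun h i hi j hj => by
      simpa [hi, hj, hi.trans_le hk, hj.trans_le hk] using h i hi j hj,
    fun h i hi j hj => by
      simpa [hi, hj, hi.trans_le hk, hj.trans_le hk] using h i hi j hj⟩

theorem coarser_restr_classes :
    Coarser (restr n Z) Y.classes ↔ ∀ i < n, ∀ j < n, Y i j → Z i j := by
  rw [coarser_iff (isPartition_restr n Z) (isPartition_classes Y)]
  simp only [pdom_restr, sameBlock_restr, sameBlock_classes, Set.mem_Iio]
  exact ⟨fun h i hi j hj hr => (h i hi j hj hr).2.2, fun h i hi j hj hr => ⟨hi, hj, h i hi j hj hr⟩⟩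

theorem coarser_restr_restr :
    Coarser (restr n Z) (restr n Y) ↔ ∀ i < n, ∀ j < n, Y i j → Z i j := by
  rw [coarser_iff (isPartition_restr n Z) (isPartition_restr n Y)]
  simp only [pdom_restr, sameBlock_restr, Set.mem_Iio]
  exact ⟨fun h i hi j hj hr => (h i hi j hj ⟨hi, hj, hr⟩).2.2,
    fun h i hi j hj hr => ⟨hi, hj, h i hi j hj hr.2.2⟩⟩

theorem ncard_restr (n : ℕ) (Y : Setoid ℕ) :
    (restr n Y).ncard = {i | i < n ∧ IsLeader Y i}.ncard := by
  have himage : restr n Y = (fun i => {j | j < n ∧ Y j i}) '' {i | i < n ∧ IsLeader Y i} := by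
    ext b
    constructor
    · rintro ⟨i, hi, rfl⟩
      refine ⟨minRep Y i, ⟨(minRep_le Y i).trans_lt hi, isLeader_minRep Y i⟩, ?_⟩
      ext l
      exact ⟨fun h => ⟨h.1, Y.trans' h.2 (Y.symm' (rel_minRep Y i))⟩,
        fun h => ⟨h.1, Y.trans' h.2 (rel_minRep Y i)⟩⟩
    · rintro ⟨i, hi, rfl⟩
      exact ⟨i, hi.1, rfl⟩
  have hinj : Set.InjOn (fun i => {j | j < n ∧ Y j i}) {i | i < n ∧ IsLeader Y i} := by
    intro a ha b hb hab
    have h : a < n ∧ Y a b := (Set.ext_iff.1 hab a).1 ⟨ha.1, Y.refl' a⟩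
    rw [← minRep_eq_of_isLeader ha.2, ← minRep_eq_of_isLeader hb.2]
    exact minRep_eq_iff.2 h.2
  rw [himage, hinj.ncard_image]

theorem ncard_restr_succ (h : IsLeader Y n) :
    (restr (n + 1) Y).ncard = (restr n Y).ncard + 1 := by
  rw [ncard_restr, ncard_restr, ← Set.ncard_insert_of_notMem (a := n) (by simp)
    ((Set.finite_Iio n).subset fun i hi => hi.1)]
  congr 1
  ext i
  simp only [Set.mem_ofPred_eq, Set.mem_insert_iff]
  constructor
  · rintro ⟨hi, hl⟩
    rcases Nat.lt_succ_iff_lt_or_eq.1 hi with h' | h'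
    · exact Or.inr ⟨h', hl⟩
    · exact Or.inl h'
  · rintro (rfl | ⟨hi, hl⟩)
    · exact ⟨Nat.lt_succ_self _, h⟩
    · exact ⟨by omega, hl⟩

theorem ncard_restr_eq_iff (hk : k ≤ n) :
    (restr n Y).ncard = (restr k Y).ncard ↔ ∀ i < n, ∃ j < k, Y i j := by
  have hsub : {i | i < k ∧ IsLeader Y i} ⊆ {i | i < n ∧ IsLeader Y i} :=
    fun i hi => ⟨hi.1.trans_le hk, hi.2⟩
  rw [ncard_restr, ncard_restr]
  constructor
  · intro h i hi
    have heq := Set.eq_of_subset_of_ncard_le hsub h.le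
      ((Set.finite_Iio n).subset fun i hi => hi.1)
    have hmem : minRep Y i ∈ {i | i < n ∧ IsLeader Y i} :=
      ⟨(minRep_le Y i).trans_lt hi, isLeader_minRep Y i⟩
    rw [← heq] at hmem
    exact ⟨_, hmem.1, rel_minRep Y i⟩
  · intro h
    congr 1
    refine Set.Subset.antisymm (fun i hi => ⟨?_, hi.2⟩) hsub
    obtain ⟨j, hj, hr⟩ := h i hi.1
    by_contra hlt
    exact hi.2 j (by omega) (Y.symm' hr)

theorem IsNext.ncard_restr (h : IsNext k Y n) : (restr n Y).ncard = (restr k Y).ncard :=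
  (ncard_restr_eq_iff h.1).2 h.2.2

end Translation

/-! ### The family of setoids attached to a game filter -/

section GameFilter

variable {F : Set (Set (Set ℕ))} {P : Set (Set ℕ)} {k n K : ℕ} {X Y Z : Setoid ℕ}

/-- The setoids whose classes form a member of `F`. -/
def setoidFam (F : Set (Set (Set ℕ))) : Set (Setoid ℕ) := {Y | Y.classes ∈ F}

theorem mem_setoidFam : Y ∈ setoidFam F ↔ Y.classes ∈ F := Iff.rfl

theorem InfPart.exists_setoid (h : InfPart P) : ∃ Y : Setoid ℕ, Y.classes = P :=
  ⟨setoidOf h.1, classes_setoidOf h.1 h.2.1⟩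

theorem pmeet_classes (Y Z : Setoid ℕ) : pmeet Y.classes Z.classes = (Y ⊔ Z).classes := by
  have hrel : ∀ a c, Relation.EqvGen
      (fun u v => sameBlock Y.classes u v ∨ sameBlock Z.classes u v) a c ↔ (Y ⊔ Z) c a := by
    intro a c
    simp only [sameBlock_classes]
    rw [Setoid.sup_eq_eqvGen]
    exact ⟨fun h => .symm _ _ h, fun h => .symm _ _ h⟩
  simp only [pmeet, pdom_classes, Set.union_self, Set.mem_univ, true_and, hrel]
  rfl

theorem mergeBelow_top_mono (K : ℕ) (h : Y ≤ Z) : mergeBelow K ⊤ Y ≤ mergeBelow K ⊤ Z := by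
  rintro i j (⟨h1, h2, -⟩ | ⟨-, h2⟩)
  · exact Or.inl ⟨(minRep_anti h i).trans_lt h1, (minRep_anti h j).trans_lt h2, trivial⟩
  · exact le_mergeBelow K ⊤ Z (h (minRep_eq_iff.1 h2))

theorem IsPFilter.exists_isLeader (hF : IsPFilter F) (hY : Y ∈ setoidFam F) (k : ℕ) :
    ∃ n ≥ k, IsLeader Y n :=
  infPart_classes.1 (hF.mem_infPart _ hY) k

theorem IsPFilter.mem_of_le (hF : IsPFilter F) (hY : Y ∈ setoidFam F) (h : Z ≤ Y) :
    Z ∈ setoidFam F := by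
  refine hF.upward _ hY _ (infPart_classes.2 fun k => ?_) (coarser_classes.2 h)
  obtain ⟨n, hn, hl⟩ := hF.exists_isLeader hY k
  exact ⟨n, hn, hl.mono h⟩

theorem IsPFilter.sup_mem (hF : IsPFilter F) (hY : Y ∈ setoidFam F) (hZ : Z ∈ setoidFam F) :
    Y ⊔ Z ∈ setoidFam F := by
  have := hF.meet_mem _ hY _ hZ
  rwa [pmeet_classes] at this

/-- An ultrafilter is closed under merging finitely many blocks. -/
theorem IsPUltrafilter.mergeBelow_top_mem (hF : IsPUltrafilter F) (hY : Y ∈ setoidFam F)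
    (K : ℕ) : mergeBelow K ⊤ Y ∈ setoidFam F := by
  let G : Set (Set (Set ℕ)) :=
    {P | ∃ V W : Setoid ℕ, V.classes = P ∧ W ∈ setoidFam F ∧ V ≤ mergeBelow K ⊤ W}
  have hinf : ∀ V W : Setoid ℕ, W ∈ setoidFam F → V ≤ mergeBelow K ⊤ W → InfPart V.classes := by
    intro V W hW hVW
    refine infPart_classes.2 fun k => ?_
    obtain ⟨n, hn, hl⟩ := hF.1.exists_isLeader hW (max k K)
    exact ⟨n, (le_max_left _ _).trans hn,
      (hl.mergeBelow ((le_max_right _ _).trans hn) ⊤).mono hVW⟩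
  have hmeet : ∀ P ∈ G, ∀ Q ∈ G, pmeet P Q ∈ G := by
    rintro _ ⟨V, W, rfl, hW, hVW⟩ _ ⟨V', W', rfl, hW', hVW'⟩
    exact ⟨V ⊔ V', W ⊔ W', (pmeet_classes V V').symm, hF.1.sup_mem hW hW', sup_le
      (hVW.trans (mergeBelow_top_mono K le_sup_left))
      (hVW'.trans (mergeBelow_top_mono K le_sup_right))⟩
  have hGinf : ∀ P ∈ G, InfPart P := by
    rintro _ ⟨V, W, rfl, hW, hVW⟩
    exact hinf V W hW hVW
  have hG : IsPFilter G :=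
    { mem_infPart := hGinf
      empty_not_mem := fun h => (hGinf ∅ h).2.2 Set.finite_empty
      upward := by
        rintro _ ⟨V, W, rfl, hW, hVW⟩ Q hQ hc
        obtain ⟨U, rfl⟩ := hQ.exists_setoid
        exact ⟨U, W, rfl, hW, (coarser_classes.1 hc).trans hVW⟩
      meet_infPart := fun P hP Q hQ => hGinf _ (hmeet P hP Q hQ)
      meet_mem := hmeet }
  have hFG : F ⊆ G := by
    intro P hP
    obtain ⟨V, rfl⟩ := (hF.1.mem_infPart P hP).exists_setoid
    exact ⟨V, V, rfl, hP, le_mergeBelow K ⊤ V⟩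
  rw [mem_setoidFam, hF.2 G hG hFG]
  exact ⟨_, Y, rfl, hY, le_rfl⟩

/-- A partition that fuses a sequence of partitions with strictly increasing stems. -/
theorem exists_ext_of_fusion {A : Set (Setoid ℕ)} {N : ℕ → ℕ} {S : ℕ → Setoid ℕ}
    (hX : X ≤ S 0) (hXa : Agree k X (S 0)) (hN : IsNext k (S 0) (N 0))
    (hS : ∀ m, S m ≤ S (m + 1)) (hSa : ∀ m, Agree (N m + 1) (S m) (S (m + 1)))
    (hSN : ∀ m, IsNext (N m + 1) (S (m + 1)) (N (m + 1)))
    (hZ : Z ∈ A) (hZa : ∀ m, Agree (N m) (S m) Z) :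
    Ext A k X Z ∧ ∀ n ≥ k, IsLeader Z n → ∃ m, n = N m ∧ Ext A (n + 1) (S m) Z := by
  have hmono : StrictMono N := strictMono_nat_of_lt_succ fun m => (hSN m).1
  have hSmono : Monotone S := monotone_nat_of_le_succ hS
  have hle : ∀ m, S m ≤ Z := by
    intro m i j hij
    let m' := m + i + j + 1
    have hm' : m' ≤ N m' := hmono.id_le m'
    exact (hZa m' i (by omega) j (by omega)).1 (hSmono (by omega : m ≤ m') hij)
  have hag : ∀ m, Agree (N m + 1) (S m) Z := fun m =>
    (hSa m).trans ((hZa (m + 1)).of_le (hSN m).1)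
  refine ⟨⟨hZ, hX.trans (hle 0), hXa.trans ((hZa 0).of_le hN.1)⟩, fun n hn hl => ?_⟩
  suffices ∃ m, n = N m by
    obtain ⟨m, rfl⟩ := this
    exact ⟨m, rfl, hZ, hle m, hag m⟩
  by_contra! hne
  have hlt : ∀ m, N m < n := by
    intro m
    induction m with
    | zero =>
      refine lt_of_le_of_ne (not_lt.1 fun h => ?_) (hne 0).symm
      obtain ⟨j, hj, hr⟩ := hN.2.2 n h
      exact hl j (hj.trans_le hn) (Z.symm' (hle 0 hr))
    | succ m ih =>
      refine lt_of_le_of_ne (not_lt.1 fun h => ?_) (hne (m + 1)).symm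
      obtain ⟨j, hj, hr⟩ := (hSN m).2.2 n h
      exact hl j (by omega) (Z.symm' (hle (m + 1) hr))
  exact absurd (hlt n) (not_lt.2 (hmono.id_le n))

end GameFilter

section Strategy

open scoped Classical in
/-- The setoid of a partition of `ℕ`, with a default value for other families of sets. -/
noncomputable def blockSetoid (P : Set (Set ℕ)) : Setoid ℕ :=
  if h : IsPartition P then setoidOf h else ⊥

open scoped Classical in
/-- A good state extending `X` over a stem of length `k`, if there is one. -/
noncomputable def nextState (A : Set (Setoid ℕ)) (good : ℕ → Setoid ℕ → Prop) (k : ℕ)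
    (X : Setoid ℕ) : ℕ × Setoid ℕ :=
  if h : ∃ p : ℕ × Setoid ℕ, Ext A k X p.2 ∧ IsNext k p.2 p.1 ∧ good (p.1 + 1) p.2 then h.choose
  else (0, ⊥)

/-- The state reached after the replies `L` of the second player. -/
noncomputable def stateAfter (A : Set (Setoid ℕ)) (good : ℕ → Setoid ℕ → Prop) (k : ℕ)
    (X : Setoid ℕ) (L : List (Set (Set ℕ))) : ℕ × Setoid ℕ :=
  L.foldl (fun p P => nextState A good (p.1 + 1) (blockSetoid P)) (nextState A good k X)

variable {F : Set (Set (Set ℕ))} {A : Set (Setoid ℕ)} {good : ℕ → Setoid ℕ → Prop} {k n : ℕ}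
  {X Y Z : Setoid ℕ} {P : Set (Set ℕ)}

theorem InfPart.classes_blockSetoid (h : InfPart P) : (blockSetoid P).classes = P := by
  rw [blockSetoid, dif_pos h.1, classes_setoidOf h.1 h.2.1]

theorem nextState_spec (h : ∃ Y n, Ext A k X Y ∧ IsNext k Y n ∧ good (n + 1) Y) :
    Ext A k X (nextState A good k X).2 ∧
      IsNext k (nextState A good k X).2 (nextState A good k X).1 ∧
      good ((nextState A good k X).1 + 1) (nextState A good k X).2 := by
  have h' : ∃ p : ℕ × Setoid ℕ, Ext A k X p.2 ∧ IsNext k p.2 p.1 ∧ good (p.1 + 1) p.2 := by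
    obtain ⟨Y, n, h⟩ := h
    exact ⟨(n, Y), h⟩
  rw [nextState, dif_pos h']
  exact h'.choose_spec

theorem stateAfter_ofFn_succ (V : ℕ → Set (Set ℕ)) (m : ℕ) :
    stateAfter A good k X (List.ofFn fun i : Fin (m + 1) => V i) =
      nextState A good ((stateAfter A good k X (List.ofFn fun i : Fin m => V i)).1 + 1)
        (blockSetoid (V m)) := by
  rw [List.ofFn_succ', List.concat_eq_append, stateAfter, List.foldl_append]
  rfl

/-- A legal reply to the move given by a state extends that state. -/
theorem ext_of_mem_ellNbhd (hl : IsLeader Y n) (hP : P ∈ F)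
    (h : P ∈ EllNbhd (sStar (restr n Y)) Y.classes) :
    (blockSetoid P).classes = P ∧ Ext (setoidFam F) (n + 1) Y (blockSetoid P) := by
  obtain ⟨hinf, hseg, hco⟩ := h
  have hcl := hinf.classes_blockSetoid
  rw [sStar_restr hl, ← hcl, segment_restr_classes] at hseg
  rw [← hcl, coarser_classes] at hco
  exact ⟨hcl, (mem_setoidFam.2 (by rwa [hcl])), hco, hseg⟩

theorem GameFilter.game (hF : GameFilter F) (hX : X ∈ setoidFam F) (hgood : good k X)
    (hstep : ∀ k' X', good k' X' → ∀ X'', Ext (setoidFam F) k' X' X'' →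
      ∃ Y n, Ext (setoidFam F) k' X'' Y ∧ IsNext k' Y n ∧ good (n + 1) Y) :
    ∃ Y, Ext (setoidFam F) k X Y ∧ ∀ n ≥ k, IsLeader Y n →
      ∃ Y', Ext (setoidFam F) (n + 1) Y' Y ∧ good (n + 1) Y' := by
  set A := setoidFam F with hAdef
  have hnot := hF.2 fun L => (restr (stateAfter A good k X L).1 (stateAfter A good k X L).2,
    (stateAfter A good k X L).2.classes)
  rw [WinningStratI] at hnot
  push Not at hnot
  obtain ⟨t, Y, V, hfol, hlose⟩ := hnot
  set N : ℕ → ℕ := fun m => (stateAfter A good k X (List.ofFn fun i : Fin m => V i)).1 with hN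
  set S : ℕ → Setoid ℕ :=
    fun m => (stateAfter A good k X (List.ofFn fun i : Fin m => V i)).2 with hS
  have ht : ∀ m, t m = restr (N m) (S m) := fun m => (congrArg Prod.fst (hfol m)).symm
  have hY : ∀ m, Y m = (S m).classes := fun m => (congrArg Prod.snd (hfol m)).symm
  have hzero : Ext A k X (S 0) ∧ IsNext k (S 0) (N 0) ∧ good (N 0 + 1) (S 0) :=
    nextState_spec (hstep k X hgood X (Ext.refl k hX))
  have hreply : ∀ m, IsLeader (S m) (N m) → LegalII F t Y V m →
      (blockSetoid (V m)).classes = V m ∧ Ext A (N m + 1) (S m) (blockSetoid (V m)) := by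
    intro m hl hII
    obtain ⟨hVF, hV⟩ := hII
    rw [ht, hY] at hV
    exact ext_of_mem_ellNbhd hl hVF hV
  have hsucc : ∀ m, good (N m + 1) (S m) → Ext A (N m + 1) (S m) (blockSetoid (V m)) →
      Ext A (N m + 1) (blockSetoid (V m)) (S (m + 1)) ∧
      IsNext (N m + 1) (S (m + 1)) (N (m + 1)) ∧ good (N (m + 1) + 1) (S (m + 1)) := by
    intro m hg hext
    have := nextState_spec (hstep _ _ hg _ hext)
    simp only [hN, hS, stateAfter_ofFn_succ]
    exact this
  have hstate : ∀ m, (∀ l < m, LegalII F t Y V l) →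
      S m ∈ A ∧ IsLeader (S m) (N m) ∧ good (N m + 1) (S m) := by
    intro m
    induction m with
    | zero => exact fun _ => ⟨hzero.1.1, hzero.2.1.2.1, hzero.2.2⟩
    | succ m ih =>
      intro hII
      obtain ⟨-, hl, hg⟩ := ih fun l hlm => hII l (by omega)
      obtain ⟨h1, h2, h3⟩ := hsucc m hg (hreply m hl (hII m (by omega))).2
      exact ⟨h1.1, h2.2.1, h3⟩
  have hlegal : ∀ n, (∀ m < n, LegalII F t Y V m) → LegalI F t Y V n := by
    intro n hII
    obtain ⟨hmem, hl, -⟩ := hstate n hII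
    rw [LegalI, ht, hY]
    refine ⟨finPart_restr _ _, hmem, ⟨(S n).classes, hF.1.1.mem_infPart _ hmem, ?_, ?_⟩, ?_⟩
    · rw [sStar_restr hl, segment_restr_classes]
      exact Agree.refl _ _
    · exact coarser_classes.2 le_rfl
    · rintro m rfl
      obtain ⟨-, hlm, hgm⟩ := hstate m fun l hlm => hII l (by omega)
      obtain ⟨hcl, hext⟩ := hreply m hlm (hII m (by omega))
      obtain ⟨h1, h2, -⟩ := hsucc m hgm hext
      have hag := (hext.trans h1).2.2
      have hle : N m + 1 ≤ N (m + 1) := h2.1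
      rw [ht, sStar_restr hl, sStar_restr hlm]
      refine ⟨(segment_restr_restr (by omega)).2 hag, ?_, ?_⟩
      · rw [← hcl, coarser_restr_classes]
        exact fun i _ j _ hij => h1.2.1 hij
      · rw [h2.ncard_restr, ← ncard_restr_succ hlm, restr_congr hag]
  obtain ⟨hII, Z, hZ, hseg, hZF⟩ := hlose hlegal
  obtain ⟨Z, rfl⟩ := hZ.exists_setoid
  have hall := fun m => hstate m fun l _ => hII l
  have hext := fun m => (hreply m (hall m).2.1 (hII m)).2
  have hnext := fun m => hsucc m (hall m).2.2 (hext m)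
  obtain ⟨hXZ, hlead⟩ := exists_ext_of_fusion (A := A) (Z := Z) hzero.1.2.1 hzero.1.2.2 hzero.2.1
    (fun m => ((hext m).trans (hnext m).1).2.1) (fun m => ((hext m).trans (hnext m).1).2.2)
    (fun m => (hnext m).2.1) hZF fun m => segment_restr_classes.1 (ht m ▸ hseg m)
  refine ⟨Z, hXZ, fun n hn hl => ?_⟩
  obtain ⟨m, rfl, hm⟩ := hlead n hn hl
  exact ⟨S m, hm, (hall m).2.2⟩

theorem GameFilter.gameFam (hF : GameFilter F) : GameFam (setoidFam F) where
  exists_isLeader _ hY k := hF.1.1.exists_isLeader hY k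
  mem_of_le _ hY _ h := hF.1.1.mem_of_le hY h
  mergeBelow_top_mem _ hY K := hF.1.mergeBelow_top_mem hY K
  game _ _ _ hX hgood hstep := hF.game hX hgood hstep

end Strategy

section Conclusion

variable {A : Set (Setoid ℕ)} {P Q u : Set (Set ℕ)} {k n : ℕ} {Y : Setoid ℕ}

theorem Segment.pdom_subset (h : Segment P Q) : pdom P ⊆ pdom Q := by
  rintro i ⟨p, hp, hi⟩
  obtain ⟨q, hq, hpq⟩ := h p hp
  exact ⟨q, hq, (hpq ▸ hi : i ∈ q ∩ pdom P).1⟩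

theorem eq_restr_of_segment (hP : IsPartition P) (hdom : pdom P = Set.Iio n)
    (h : Segment P Y.classes) : P = restr n Y := by
  rw [← restr_setoidOf hP hdom] at h ⊢
  exact restr_congr (segment_restr_classes.1 h)

theorem isLeader_setoidOf (hP : IsPartition P) (hdom : pdom P = Set.Iio n) :
    IsLeader (setoidOf hP) n := by
  intro i hi hr
  have hmem := ((setoidOf_apply hP (hdom ▸ hi)).1 hr).symm.mem_left
  exact lt_irrefl n (hdom.le hmem)

theorem isLeader_of_coarser_sStar (hP : IsPartition P) (hdom : pdom P = Set.Iio n)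
    (h : Coarser (sStar P) Y.classes) : IsLeader Y n ∧ Coarser P (restr n Y) := by
  have hl := isLeader_setoidOf hP hdom
  rw [← restr_setoidOf hP hdom, sStar_restr hl, coarser_restr_classes] at h
  refine ⟨fun i hi hr => hl i hi (h i (by omega) n (by omega) hr), ?_⟩
  rw [← restr_setoidOf hP hdom, coarser_restr_restr]
  exact fun i hi j hj => h i (by omega) j (by omega)

/-- A coarsening of a finite restriction of `Y` is the restriction of an extension of `Y`. -/
theorem GameFam.exists_ext_restr_eq (hA : GameFam A) (hY : Y ∈ A) (hl : IsLeader Y n)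
    (hu : IsPartition u) (hdom : pdom u = Set.Iio n) (hco : Coarser u (restr n Y))
    (hseg : Segment (restr k Y) u) (hcard : u.ncard = (restr k Y).ncard) :
    ∃ W, Ext A k Y W ∧ IsNext k W n ∧ restr n W = u := by
  have hkn : k ≤ n := by
    have := hseg.pdom_subset
    rwa [hdom, pdom_restr, Set.Iio_subset_Iio_iff] at this
  have hU := restr_setoidOf hu hdom
  set U := setoidOf hu
  rw [← hU] at hco hseg hcard
  rw [coarser_restr_restr] at hco
  rw [segment_restr_restr hkn] at hseg
  have hrep : ∀ i < n, U i (minRep Y i) := fun i hi =>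
    hco i hi _ ((minRep_le Y i).trans_lt hi) (rel_minRep Y i)
  have hag : Agree n (mergeBelow n U Y) U := by
    intro i hi j hj
    rw [mergeBelow_apply_of_lt hi hj]
    exact ⟨fun h => U.trans' (hrep i hi) (U.trans' h (U.symm' (hrep j hj))),
      fun h => U.trans' (U.symm' (hrep i hi)) (U.trans' h (hrep j hj))⟩
  have hYW : Agree k Y (mergeBelow n U Y) := hseg.trans (hag.symm.of_le hkn)
  refine ⟨mergeBelow n U Y, ⟨hA.mergeBelow_mem U n hY, le_mergeBelow n U Y, hYW⟩,
    ⟨hkn, hl.mergeBelow le_rfl U, ?_⟩, (restr_congr hag).trans hU⟩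
  rw [← ncard_restr_eq_iff hkn, restr_congr hag, hcard, restr_congr hYW]

end Conclusion

theorem lemma_l65 (F : Set (Set (Set ℕ))) (hF : GameFilter F)
    (s t X : Set (Set ℕ)) (hs : FinPart s) (ht : FinPart t) (hX : X ∈ F)
    (hst : Segment s t) (htX : Segment t X)
    (D : Set (Set (Set ℕ))) (hD : D ⊆ nsegOmega s s.ncard)
    (hdense : ZeroDense F D s X)
    (Z : Set (Set ℕ)) (hZ : Z ∈ EllNbhd t X) (hZF : Z ∈ F)
    (hK : DenseIn F {u | FinPart u ∧ Segment t u ∧ (iseg0 s u ∩ D).Nonempty} t Z) :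
    ∃ tbar, FinPart tbar ∧ Segment t tbar ∧ tbar.ncard = t.ncard + 1 ∧
      Coarser (sStar tbar) Z ∧ iseg0 s tbar ⊆ D := by
  have hA := hF.gameFam
  obtain ⟨hsP, k, hsk⟩ := hs
  obtain ⟨htP, K, htK⟩ := ht
  obtain ⟨X, rfl⟩ := (hF.1.1.mem_infPart X hX).exists_setoid
  obtain ⟨Z, rfl⟩ := hZ.1.exists_setoid
  have hkK : k ≤ K := by
    have := hst.pdom_subset
    rwa [hsk, htK, Set.Iio_subset_Iio_iff] at this
  obtain rfl := eq_restr_of_segment htP htK htX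
  have hsX : s = restr k X := by
    rw [← restr_setoidOf hsP hsk, segment_restr_restr hkK] at hst
    rw [← restr_congr hst, restr_setoidOf hsP hsk]
  subst hsX
  have hXZ : Ext (setoidFam F) K X Z :=
    ⟨hZF, coarser_classes.1 hZ.2.2, segment_restr_classes.1 hZ.2.1⟩
  have hInv : Inv (setoidFam F) (fun n Y => restr n Y ∈ D) := by
    intro n Y _ W _ _ _ ha h
    rwa [← restr_congr ha]
  have hDense : Dense (setoidFam F) k (fun n Y => restr n Y ∈ D) X := by
    intro Y hY
    obtain ⟨u, huD, -, hco⟩ := hdense Y.classes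
      ⟨hF.1.1.mem_infPart _ hY.1, segment_restr_classes.2 hY.2.2, coarser_classes.2 hY.2.1⟩ hY.1
    obtain ⟨⟨huP, n, hun⟩, hcard, hseg⟩ := hD huD
    obtain ⟨hl, hco'⟩ := isLeader_of_coarser_sStar huP hun hco
    rw [restr_congr hY.2.2] at hseg hcard
    obtain ⟨W, hW, hn, rfl⟩ := hA.exists_ext_restr_eq hY.1 hl huP hun hco' hseg hcard
    exact ⟨W, n, hW, hn, huD⟩
  have hstem : ∃ Y, Ext (setoidFam F) K Z Y ∧ ∀ W n, Ext (setoidFam F) k Y W →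
      IsNext k W n → K ≤ n → 0 < n → restr n W ∈ D := by
    rcases Nat.eq_zero_or_pos k with rfl | hk0
    · refine ⟨Z, Ext.refl K hZF, fun W n _ hn _ h0 => ?_⟩
      obtain ⟨j, hj, -⟩ := hn.2.2 0 h0
      omega
    · obtain ⟨Y, hY, hall⟩ := (hDense.of_ext (hXZ.of_le hkK)).exists_forall_stem hA hInv hk0 hkK hZF
      exact ⟨Y, hY, fun W n hW hn hK _ => hall W n hW hn hK⟩
  obtain ⟨Y, hY, hall⟩ := hstem
  obtain ⟨n, hn⟩ := hA.exists_isNext hY.1 K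
  obtain ⟨m, hm⟩ := hA.exists_isNext hY.1 (n + 1)
  have hXY : Agree K X Y := hXZ.2.2.trans hY.2.2
  have hKm : K ≤ m := by
    have h1 := hn.1
    have h2 := hm.1
    omega
  refine ⟨restr m Y, finPart_restr m Y, (segment_restr_restr hKm).2 hXY, ?_, ?_, ?_⟩
  · rw [hm.ncard_restr, ncard_restr_succ hn.2.1, hn.ncard_restr, restr_congr hXY]
  · rw [sStar_restr hm.2.1, coarser_restr_classes]
    exact fun i _ j _ hij => hY.2.1 hij
  · rintro u ⟨⟨huP, -⟩, hdom, hseg, hco, hcard⟩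
    rw [pdom_restr] at hdom
    rw [restr_congr (hXY.of_le hkK)] at hseg hcard
    obtain ⟨W, hW, hWm, rfl⟩ := hA.exists_ext_restr_eq hY.1 hm.2.1 huP hdom hco hseg hcard
    exact hall W m hW hWm hKm (by have := hm.1; omega)

end DualRamsey
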